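/- arXiv:1602.00249 — 6 statements merged into one kernel-verified Lean document; each statement's English description precedes it below -/
import Mathlib

section
/- Let (N⁺, Y, N) be a standard triple in End(V) consisting of infinitesimal isometries of Q, and for an integer ℓ ≥ 0 let P(ℓ) = ker(N^{ℓ+1}) ∩ {v ∈ V : Yv = ℓ·v} be the space of primitive vectors of weight ℓ. Then the bilinear form Q_ℓ(u, v) := Q(u, N^ℓ v) restricts to a nondegenerate bilinear form on P(ℓ) satisfying Q_ℓ(u, v) = (−1)^{w+ℓ} Q_ℓ(v, u) for all u, v ∈ P(ℓ); in particular, if w + ℓ is odd then dim P(ℓ) is even. -/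
structure IsStandardTriple {V : Type*} [AddCommGroup V] [Module ℂ V]
    (E H F : Module.End ℂ V) : Prop where
  raise : ∀ x, H (E x) = E (H x) + (2 : ℂ) • E x
  lower : ∀ x, H (F x) = F (H x) - (2 : ℂ) • F x
  comm : ∀ x, E (F x) = F (E x) + H x

namespace IsStandardTriple

variable {V : Type*} [AddCommGroup V] [Module ℂ V] {E H F : Module.End ℂ V}

theorem symm (t : IsStandardTriple E H F) : IsStandardTriple F (-H) E where
  raise x := by simp [t.lower]; abel
  lower x := by simp [t.raise]; abel
  comm x := by simp [t.comm]

theorem apply_pow_raise (t : IsStandardTriple E H F) (n : ℕ) (x : V) :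
    H ((E ^ n) x) = (E ^ n) (H x) + (2 * n : ℂ) • (E ^ n) x := by
  induction n with
  | zero => simp
  | succ n ih =>
    simp only [pow_succ', Module.End.mul_apply, t.raise, ih, map_add, map_smul]
    push_cast
    module

theorem apply_pow_lower (t : IsStandardTriple E H F) (n : ℕ) (x : V) :
    H ((F ^ n) x) = (F ^ n) (H x) - (2 * n : ℂ) • (F ^ n) x := by
  have h := t.symm.apply_pow_raise n x
  simp only [LinearMap.neg_apply, map_neg] at h
  linear_combination (norm := module) -h

/-- The commutation relation between the raising operator and powers of the lowering operator. -/
theorem raise_pow_lower (t : IsStandardTriple E H F) (n : ℕ) (x : V) :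
    E ((F ^ (n + 1)) x) =
      (F ^ (n + 1)) (E x) + (n + 1 : ℂ) • (F ^ n) (H x - (n : ℂ) • x) := by
  induction n with
  | zero => simp [t.comm]
  | succ n ih =>
    rw [pow_succ' F (n + 1), Module.End.mul_apply, t.comm, ih, t.apply_pow_lower]
    simp only [pow_succ', Module.End.mul_apply, map_add, map_sub, map_smul]
    push_cast
    module

theorem exists_pow_raise_eq_zero [FiniteDimensional ℂ V] (t : IsStandardTriple E H F)
    {k : ℂ} {v : V} (hv : H v = k • v) : ∃ n : ℕ, (E ^ n) v = 0 := by
  by_contra! hne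
  have hinj : Function.Injective (fun n : ℕ => k + 2 * (n : ℂ)) := fun a b hab => by
    simpa using hab
  have hli := Module.End.eigenvectors_linearIndependent' H
    (fun n : ℕ => k + 2 * (n : ℂ)) hinj (fun n => (E ^ n) v) fun n =>
      ⟨Module.End.mem_eigenspace_iff.2 (by
        rw [t.apply_pow_raise, hv, map_smul, add_smul]), hne n⟩
  exact not_finite_iff_infinite.2 inferInstance hli.finite

/-- The eigenvalue of `F E` on a weight vector of weight `k` comes from a highest weight
`k + 2 m`. -/
theorem exists_eigenvalue_lower_raise [FiniteDimensional ℂ V] (t : IsStandardTriple E H F)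
    {k a : ℂ} {v : V} (hv0 : v ≠ 0) (hv : H v = k • v) (ha : F (E v) = a • v) :
    ∃ m : ℕ, a = m * (m + 1 + k) := by
  classical
  have hex := t.exists_pow_raise_eq_zero hv
  have key (j : ℕ) : F (E ((E ^ j) v)) = (a - j * (k + j + 1)) • (E ^ j) v := by
    induction j with
    | zero => simp [ha]
    | succ j ih =>
      have h1 := t.comm (E ((E ^ j) v))
      rw [ih, t.raise, t.apply_pow_raise, hv] at h1
      simp only [map_add, map_smul] at h1
      simp only [pow_succ', Module.End.mul_apply]
      push_cast
      linear_combination (norm := module) -h1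
  obtain ⟨m, hm⟩ : ∃ m, Nat.find hex = m + 1 := by
    refine Nat.exists_eq_succ_of_ne_zero fun h => hv0 ?_
    simpa [h] using Nat.find_spec hex
  have hz : E ((E ^ m) v) = 0 := by
    simpa [hm, pow_succ'] using Nat.find_spec hex
  have hnz : (E ^ m) v ≠ 0 := Nat.find_min hex (by omega)
  have h := key m
  rw [hz, map_zero, eq_comm, smul_eq_zero_iff_left hnz] at h
  exact ⟨m, by linear_combination h⟩

theorem eq_zero_of_raise_lower_eq_zero [FiniteDimensional ℂ V] (t : IsStandardTriple E H F)
    {k : ℕ} (hk : 0 < k) {v : V} (hv : H v = (k : ℂ) • v) (h : E (F v) = 0) : v = 0 := by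
  by_contra hv0
  obtain ⟨m, hm⟩ := t.exists_eigenvalue_lower_raise (a := -k) hv0 hv (by
    have := t.comm v
    rw [h, hv] at this
    linear_combination (norm := module) -this)
  have : m * (m + 1 + k) + k = 0 := by
    have h' : ((m * (m + 1 + k) + k : ℕ) : ℂ) = 0 := by
      push_cast
      linear_combination -hm
    exact_mod_cast h'
  omega

theorem eq_zero_of_lower_raise_eq_zero [FiniteDimensional ℂ V] (t : IsStandardTriple E H F)
    {k : ℕ} (hk : 0 < k) {v : V} (hv : H v = -(k : ℂ) • v) (h : F (E v) = 0) : v = 0 :=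
  t.symm.eq_zero_of_raise_lower_eq_zero hk (by simp [hv]) h

theorem pow_lower_ne_zero [FiniteDimensional ℂ V] (t : IsStandardTriple E H F)
    {k : ℕ} {a : ℂ} {v : V} (hv0 : v ≠ 0) (hv : H v = (k : ℂ) • v) (ha : F (E v) = a • v)
    {j : ℕ} (hj : j ≤ k) : (F ^ j) v ≠ 0 := by
  obtain ⟨m, hm⟩ := t.exists_eigenvalue_lower_raise hv0 hv ha
  induction j with
  | zero => simpa
  | succ j ih =>
    intro h0
    have key := t.raise_pow_lower j v
    have hFE : (F ^ (j + 1)) (E v) = a • (F ^ j) v := by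
      rw [pow_succ, Module.End.mul_apply, ha, map_smul]
    rw [h0, map_zero, hFE, hv, ← sub_smul, map_smul, smul_smul, ← add_smul, eq_comm,
      smul_eq_zero_iff_left (ih (by omega)), hm] at key
    obtain ⟨d, rfl⟩ := Nat.exists_eq_add_of_lt (Nat.lt_of_succ_le hj)
    have h' : ((m * (m + 1 + (j + d + 1)) + (j + 1) * (d + 1) : ℕ) : ℂ) = 0 := by
      push_cast at key ⊢
      linear_combination key
    have h'' : m * (m + 1 + (j + d + 1)) + (j + 1) * (d + 1) = 0 := by exact_mod_cast h'
    have : 0 < (j + 1) * (d + 1) := by positivity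
    omega

/-- `F ^ k` is injective on the weight space of weight `k`. -/
theorem eq_zero_of_pow_lower_eq_zero [FiniteDimensional ℂ V] (t : IsStandardTriple E H F)
    {k : ℕ} {v : V} (hv : H v = (k : ℂ) • v) (h : (F ^ k) v = 0) : v = 0 := by
  let S : Submodule ℂ V := LinearMap.ker (F ^ k) ⊓ LinearMap.ker (H - (k : ℂ) • 1)
  have hmem (x : V) : x ∈ S ↔ (F ^ k) x = 0 ∧ H x = (k : ℂ) • x := by
    simp [S, sub_eq_zero]
  have hS : ∀ x ∈ S, (F * E) x ∈ S := by
    intro x hx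
    rw [hmem] at hx ⊢
    have h1 := t.raise_pow_lower k x
    rw [hx.2, sub_self, map_zero, smul_zero, add_zero, pow_succ', Module.End.mul_apply, hx.1,
      map_zero, map_zero, ← pow_succ', pow_succ, Module.End.mul_apply] at h1
    refine ⟨h1.symm, ?_⟩
    simp only [Module.End.mul_apply, t.lower, t.raise, hx.2, map_add, map_smul]
    module
  by_contra hv0
  have hvS : v ∈ S := (hmem v).2 ⟨h, hv⟩
  have : Nontrivial S := ⟨⟨⟨v, hvS⟩, 0, by simpa [Subtype.ext_iff] using hv0⟩⟩
  obtain ⟨a, ha⟩ := Module.End.exists_eigenvalue ((F * E).restrict hS)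
  obtain ⟨⟨x, hxS⟩, hx, hx0⟩ := ha.exists_hasEigenvector
  have hxa : F (E x) = a • x := congrArg Subtype.val (Module.End.mem_eigenspace_iff.1 hx)
  obtain ⟨hx1, hx2⟩ := (hmem x).1 hxS
  exact t.pow_lower_ne_zero (by simpa [Subtype.ext_iff] using hx0) hx2 hxa le_rfl hx1

/-- A highest weight vector of weight `k` is killed by `F ^ (k + 1)`. -/
theorem pow_succ_lower_eq_zero [FiniteDimensional ℂ V] (t : IsStandardTriple E H F)
    {k : ℕ} {v : V} (hv : H v = (k : ℂ) • v) (h : E v = 0) : (F ^ (k + 1)) v = 0 := by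
  refine t.eq_zero_of_lower_raise_eq_zero (k := k + 2) (by omega) ?_ ?_
  · rw [t.apply_pow_lower, hv, map_smul]
    push_cast
    module
  · rw [t.raise_pow_lower, h, hv]
    simp

theorem apply_eq_smul_of_raise_eq_zero [FiniteDimensional ℂ V] (t : IsStandardTriple E H F)
    {k : ℕ} {n : ℕ} {p : V} (hE : E p = 0) (hp : ((H - (k : ℂ) • 1) ^ n) p = 0) :
    H p = (k : ℂ) • p := by
  induction n generalizing p with
  | zero => simp_all
  | succ n ih =>
    obtain ⟨z, hz⟩ : ∃ z, H p = (k : ℂ) • p + z := ⟨H p - (k : ℂ) • p, by abel⟩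
    have hz' : (H - (k : ℂ) • 1) p = z := by simp [hz]
    have hEz : E z = 0 := by
      have h1 := t.raise p
      simp only [hE, hz, map_add, map_smul, map_zero, smul_zero, zero_add, add_zero] at h1
      exact h1.symm
    have hHz : H z = (k : ℂ) • z := by
      refine ih hEz ?_
      rwa [pow_succ, Module.End.mul_apply, hz'] at hp
    have hFz := t.pow_succ_lower_eq_zero hHz hEz
    have hEq : E ((F ^ (k + 1)) p) = (k + 1 : ℂ) • (F ^ k) z := by
      rw [t.raise_pow_lower, hE, hz]
      simp
    have hq : (F ^ (k + 1)) p = 0 := by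
      refine t.eq_zero_of_lower_raise_eq_zero (k := k + 2) (by omega) ?_ ?_
      · rw [t.apply_pow_lower, hz, map_add, hFz, map_smul]
        push_cast
        module
      · rw [hEq, map_smul, ← Module.End.mul_apply, ← pow_succ', hFz, smul_zero]
    rw [hq, map_zero, eq_comm, smul_eq_zero_iff_right (Nat.cast_add_one_ne_zero k)] at hEq
    rw [hz, t.eq_zero_of_pow_lower_eq_zero hHz hEq, add_zero]

theorem sub_pow_raise (t : IsStandardTriple E H F) (k : ℂ) (n : ℕ) (x : V) :
    ((H - (k + 2) • 1) ^ n) (E x) = E (((H - k • 1) ^ n) x) := by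
  induction n generalizing x with
  | zero => simp
  | succ n ih =>
    rw [pow_succ, pow_succ, Module.End.mul_apply, Module.End.mul_apply, ← ih]
    congr 1
    simp only [LinearMap.sub_apply, LinearMap.smul_apply, Module.End.one_apply, t.raise, map_sub,
      map_smul]
    module

theorem sub_pow_lower (t : IsStandardTriple E H F) (k : ℂ) (n : ℕ) (x : V) :
    ((H - k • 1) ^ n) (F x) = F (((H - (k + 2) • 1) ^ n) x) := by
  induction n generalizing x with
  | zero => simp
  | succ n ih =>
    rw [pow_succ, pow_succ, Module.End.mul_apply, Module.End.mul_apply, ← ih]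
    congr 1
    simp only [LinearMap.sub_apply, LinearMap.smul_apply, Module.End.one_apply, t.lower, map_sub,
      map_smul]
    module

theorem eq_zero_of_raise_lower_eq_zero_of_pow [FiniteDimensional ℂ V]
    (t : IsStandardTriple E H F) {k : ℕ} (hk : 0 < k) {n : ℕ} {v : V}
    (hv : ((H - (k : ℂ) • 1) ^ n) v = 0) (h : E (F v) = 0) : v = 0 := by
  induction n generalizing v with
  | zero => simpa using hv
  | succ n ih =>
    rw [pow_succ, Module.End.mul_apply] at hv
    have h0 := ih hv (by
      have h1 := t.raise (F v)
      rw [h, t.lower] at h1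
      simp only [map_sub, map_smul, h, map_zero, smul_zero, sub_zero, add_zero] at h1
      simp [h, ← h1])
    exact t.eq_zero_of_raise_lower_eq_zero hk (by simpa [sub_eq_zero] using h0) h

/-- Every generalized weight vector of weight `k` is congruent to a highest weight vector modulo
the range of `F`. -/
theorem exists_eq_add_lower [FiniteDimensional ℂ V] (t : IsStandardTriple E H F)
    {k n : ℕ} {x : V} (hx : ((H - (k : ℂ) • 1) ^ n) x = 0) :
    ∃ p y, x = p + F y ∧ E p = 0 ∧ H p = (k : ℂ) • p := by
  let S : Submodule ℂ V := LinearMap.ker ((H - ((k : ℂ) + 2) • 1) ^ n)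
  have hS : ∀ y ∈ S, (E * F) y ∈ S := by
    intro y hy
    rw [LinearMap.mem_ker] at hy ⊢
    rw [Module.End.mul_apply, t.sub_pow_raise, t.sub_pow_lower, hy, map_zero, map_zero]
  have hinj : Function.Injective ((E * F).restrict hS) := by
    rw [injective_iff_map_eq_zero]
    rintro ⟨y, hy⟩ h
    have h' : E (F y) = 0 := congrArg Subtype.val h
    refine Subtype.ext (t.eq_zero_of_raise_lower_eq_zero_of_pow (k := k + 2) (n := n)
      (by omega) ?_ h')
    push_cast
    exact hy
  obtain ⟨⟨y, hy⟩, hyx⟩ := LinearMap.injective_iff_surjective.1 hinj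
    ⟨E x, by rw [LinearMap.mem_ker, t.sub_pow_raise, hx, map_zero]⟩
  have hyx' : E (F y) = E x := congrArg Subtype.val hyx
  have hEp : E (x - F y) = 0 := by rw [map_sub, hyx', sub_self]
  refine ⟨x - F y, y, by abel, hEp, t.apply_eq_smul_of_raise_eq_zero (n := n) hEp ?_⟩
  rw [map_sub, hx, t.sub_pow_lower, LinearMap.mem_ker.1 hy, map_zero, sub_zero]

end IsStandardTriple

theorem pow_apply_eq_of_adjoint {R M : Type*} [CommRing R] [AddCommGroup M] [Module R M]
    {Q : M →ₗ[R] M →ₗ[R] R} {X X' : Module.End R M}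
    (h : ∀ u v, Q (X u) v = Q u (X' v)) (n : ℕ) (u v : M) :
    Q ((X ^ n) u) v = Q u ((X' ^ n) v) := by
  induction n generalizing u v with
  | zero => simp
  | succ n ih => rw [pow_succ', pow_succ, Module.End.mul_apply, Module.End.mul_apply, h, ih]

/-- A vector space carrying a nondegenerate skew-symmetric form in characteristic zero has even
dimension. -/
theorem even_finrank_of_skew {K W : Type*} [Field K] [CharZero K] [AddCommGroup W] [Module K W]
    [FiniteDimensional K W] (B : LinearMap.BilinForm K W) (hskew : ∀ u v, B u v = -B v u)
    (hnd : ∀ u, (∀ v, B u v = 0) → u = 0) : Even (Module.finrank K W) := by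
  let b := Module.finBasis K W
  let M := LinearMap.BilinForm.toMatrix b B
  have hM : M.transpose = -M := by
    ext i j
    simp [M, LinearMap.BilinForm.toMatrix_apply, hskew (b j) (b i)]
  have hB : B.Nondegenerate := by
    refine ⟨hnd, fun v hv => hnd v fun u => ?_⟩
    rw [hskew, hv, neg_zero]
  have hdet : M.det ≠ 0 := (LinearMap.BilinForm.nondegenerate_iff_det_ne_zero b).1 hB
  have h := M.det_transpose
  rw [hM, Matrix.det_neg, Fintype.card_fin] at h
  by_contra hodd
  rw [Nat.not_even_iff_odd] at hodd
  rw [hodd.neg_one_pow, neg_one_mul, neg_eq_self] at h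
  exact hdet h


/-- Let `V` be a finite-dimensional complex vector space, `w : ℤ`, and `Q` a
nondegenerate bilinear form with `Q u v = (-1)^w Q v u`.  Let `(N⁺, Y, N)` be a standard triple
consisting of infinitesimal isometries of `Q`, and for `ℓ ≥ 0` let
`P(ℓ) = ker (N^(ℓ+1)) ∩ {v | Y v = ℓ • v}` be the primitive space of weight `ℓ`.
Then `Q_ℓ(u,v) = Q(u, N^ℓ v)` restricts to a nondegenerate bilinear form on `P(ℓ)` satisfying
`Q_ℓ(u,v) = (-1)^(w+ℓ) Q_ℓ(v,u)`; in particular if `w + ℓ` is odd then `dim P(ℓ)` is even. -/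
theorem stmt0 {V : Type} [AddCommGroup V] [Module ℂ V] [FiniteDimensional ℂ V]
    (w : ℤ) (Q : V →ₗ[ℂ] V →ₗ[ℂ] ℂ)
    (hQsym : ∀ u v : V, Q u v = (-1 : ℂ) ^ w * Q v u)
    (hQnd : ∀ u : V, (∀ v : V, Q u v = 0) → u = 0)
    (Np Y N : Module.End ℂ V)
    (hNpIso : ∀ u v : V, Q (Np u) v + Q u (Np v) = 0)
    (hYIso : ∀ u v : V, Q (Y u) v + Q u (Y v) = 0)
    (hNIso : ∀ u v : V, Q (N u) v + Q u (N v) = 0)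
    (hT1 : Y * Np - Np * Y = 2 • Np)
    (hT2 : Np * N - N * Np = Y)
    (hT3 : Y * N - N * Y = -(2 • N))
    (ℓ : ℕ)
    (P : Submodule ℂ V)
    (hP : P = LinearMap.ker (N ^ (ℓ + 1)) ⊓
      LinearMap.ker (Y - (ℓ : ℂ) • (1 : Module.End ℂ V))) :
    (∀ u ∈ P, ∀ v ∈ P, Q u ((N ^ ℓ) v) = (-1 : ℂ) ^ (w + (ℓ : ℤ)) * Q v ((N ^ ℓ) u)) ∧
    (∀ u ∈ P, (∀ v ∈ P, Q u ((N ^ ℓ) v) = 0) → u = 0) ∧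
    (Odd (w + (ℓ : ℤ)) → Even (Module.finrank ℂ P)) := by
  have t : IsStandardTriple Np Y N :=
    { raise := fun x => by
        have h := LinearMap.congr_fun hT1 x
        simp only [LinearMap.sub_apply, Module.End.mul_apply, LinearMap.smul_apply] at h
        rw [sub_eq_iff_eq_add'.1 h]
        module
      lower := fun x => by
        have h := LinearMap.congr_fun hT3 x
        simp only [LinearMap.sub_apply, Module.End.mul_apply, LinearMap.neg_apply,
          LinearMap.smul_apply] at h
        rw [sub_eq_iff_eq_add'.1 h, sub_eq_add_neg]
        module
      comm := fun x => by
        have h := LinearMap.congr_fun hT2 x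
        simp only [LinearMap.sub_apply, Module.End.mul_apply] at h
        exact sub_eq_iff_eq_add'.1 h }
  have hmem (x : V) : x ∈ P ↔ (N ^ (ℓ + 1)) x = 0 ∧ Y x = (ℓ : ℂ) • x := by
    simp [hP, sub_eq_zero]
  have hNpow (u v : V) : Q ((N ^ ℓ) u) v = (-1 : ℂ) ^ ℓ * Q u ((N ^ ℓ) v) := by
    rw [pow_apply_eq_of_adjoint (X' := -N) (fun u v => by
      rw [eq_neg_of_add_eq_zero_left (hNIso u v), LinearMap.neg_apply, map_neg]),
      ← neg_one_smul ℂ N, smul_pow, LinearMap.smul_apply, map_smul, smul_eq_mul]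
  have hsymm (u v : V) :
      Q u ((N ^ ℓ) v) = (-1 : ℂ) ^ (w + (ℓ : ℤ)) * Q v ((N ^ ℓ) u) := by
    rw [hQsym, hNpow, zpow_add₀ (by norm_num), zpow_natCast, mul_assoc]
  have hnd : ∀ u ∈ P, (∀ v ∈ P, Q u ((N ^ ℓ) v) = 0) → u = 0 := by
    intro u hu h
    obtain ⟨hu1, hu2⟩ := (hmem u).1 hu
    refine t.eq_zero_of_pow_lower_eq_zero hu2 (hQnd _ fun x => ?_)
    obtain ⟨n, hn, hn1⟩ := ((LinearMap.eventually_isCompl_ker_pow_range_pow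
      (Y - (ℓ : ℂ) • 1)).and (Filter.eventually_ge_atTop 1)).exists
    obtain ⟨a, ha, b, ⟨c, rfl⟩, rfl⟩ := Submodule.mem_sup.1
      (hn.sup_eq_top ▸ Submodule.mem_top (x := x))
    obtain ⟨p, y, rfl, hEp, hHp⟩ := t.exists_eq_add_lower (LinearMap.mem_ker.1 ha)
    have hp : Q ((N ^ ℓ) u) p = 0 := by
      rw [hNpow, h p ((hmem p).2 ⟨t.pow_succ_lower_eq_zero hHp hEp, hHp⟩), mul_zero]
    have hy : Q ((N ^ ℓ) u) (N y) = 0 := by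
      have := hNIso ((N ^ ℓ) u) y
      rwa [← Module.End.mul_apply, ← pow_succ', hu1, map_zero, LinearMap.zero_apply,
        zero_add] at this
    have hc (d : V) : Q ((N ^ ℓ) u) ((Y - (ℓ : ℂ) • 1) d) = 0 := by
      have := hYIso ((N ^ ℓ) u) d
      rw [t.apply_pow_lower, hu2] at this
      simp only [map_sub, map_smul, LinearMap.sub_apply, LinearMap.smul_apply,
        Module.End.one_apply, smul_eq_mul] at this ⊢
      linear_combination this
    obtain ⟨n, rfl⟩ := Nat.exists_eq_add_of_le' hn1
    rw [map_add, map_add, hp, hy, pow_succ', Module.End.mul_apply, hc, add_zero, add_zero]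
  refine ⟨fun u _ v _ => hsymm u v, hnd, fun hodd => ?_⟩
  refine even_finrank_of_skew ((Q.compl₂ (N ^ ℓ)).domRestrict₁₂ P P) (fun u v => ?_)
    fun u hu => Subtype.ext (hnd u u.2 fun v hv => hu ⟨v, hv⟩)
  have h := hsymm u v
  rw [hodd.neg_one_zpow, neg_one_mul] at h
  exact h
end

section
/- Let N₁ and N₂ be nilpotent infinitesimal isometries of Q. Then there exists g ∈ Aut(V, Q) with g ∘ N₁ ∘ g⁻¹ = N₂ if and only if rank(N₁^k) = rank(N₂^k) for every integer k ≥ 1. (This expresses that the Ad Aut(V,Q)-orbits of nilpotent elements of the symplectic Lie algebra are classified by the Jordan partition.) -/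
open Polynomial in
theorem Polynomial.exists_dvd_sq_sub_X {K : Type*} [Field K] [IsAlgClosed K] (h2 : (2 : K) ≠ 0)
    {m : K[X]} (hm : m ≠ 0) (hm0 : m.coeff 0 ≠ 0) : ∃ p : K[X], m ∣ p ^ 2 - X := by
  classical
  choose s hs using fun x : K => IsAlgClosed.exists_pow_nat_eq x two_pos
  let q := Lagrange.interpolate m.roots.toFinset id s
  have hq (r : K) (hr : r ∈ m.roots) : X - C r ∣ q ^ 2 - X := by
    rw [dvd_iff_isRoot]
    have := Lagrange.eval_interpolate_at_node (v := id) s Function.injective_id.injOn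
      (Multiset.mem_toFinset.2 hr)
    rw [id] at this
    simp only [IsRoot.def, eval_sub, eval_pow, eval_X, q, this, hs, sub_self]
  have hnil : IsNilpotent (AdjoinRoot.mk m (q ^ 2 - X)) := by
    refine ⟨m.roots.card, ?_⟩
    rw [← map_pow, AdjoinRoot.mk_eq_zero]
    conv_lhs => rw [(IsAlgClosed.splits m).eq_prod_roots]
    rw [IsUnit.mul_left_dvd (by simpa using hm)]
    have := Multiset.prod_dvd_prod_of_dvd (S := m.roots) (fun r => X - C r)
      (fun _ => q ^ 2 - X) hq
    simpa using this
  have hroot : IsUnit (AdjoinRoot.root m) := by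
    have h := congrArg (AdjoinRoot.mk m) (divX_mul_X_add m)
    rw [AdjoinRoot.mk_self, map_add, map_mul, AdjoinRoot.mk_X, AdjoinRoot.mk_C] at h
    refine isUnit_of_mul_isUnit_right (x := AdjoinRoot.mk m m.divX) ?_
    rw [eq_neg_of_add_eq_zero_left h, IsUnit.neg_iff]
    exact (IsUnit.mk0 _ hm0).map (AdjoinRoot.of m)
  have hunit : IsUnit (AdjoinRoot.mk m q) := by
    have h : IsUnit (AdjoinRoot.mk m (q ^ 2 - X) + AdjoinRoot.root m) :=
      hnil.isUnit_add_right_of_commute hroot (Commute.all _ _)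
    rw [map_sub, AdjoinRoot.mk_X, sub_add_cancel, map_pow] at h
    exact (isUnit_pow_iff two_ne_zero).1 h
  have hunit2 : IsUnit (2 : AdjoinRoot m) := by
    rw [← map_ofNat (AdjoinRoot.of m)]
    exact (IsUnit.mk0 _ h2).map (AdjoinRoot.of m)
  obtain ⟨r, ⟨-, hr⟩, -⟩ := existsUnique_nilpotent_sub_and_aeval_eq_zero
    (P := (X ^ 2 - C (AdjoinRoot.root m) : (AdjoinRoot m)[X])) (x := AdjoinRoot.mk m q)
    (by simpa using hnil)
    (by simpa [one_add_one_eq_two] using hunit2.mul hunit)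
  obtain ⟨p, rfl⟩ := AdjoinRoot.mk_surjective r
  exact ⟨p, by rw [← AdjoinRoot.mk_eq_zero]; simpa using hr⟩

open Polynomial in
theorem Module.End.exists_aeval_sq_eq {K V : Type*} [Field K] [IsAlgClosed K] (h2 : (2 : K) ≠ 0)
    [AddCommGroup V] [Module K V] [FiniteDimensional K V] {A : Module.End K V}
    (hA : Function.Injective A) : ∃ p : K[X], aeval A p ^ 2 = A := by
  have h0 : (minpoly K A).coeff 0 ≠ 0 := by
    rw [coeff_zero_eq_eval_zero]
    intro h
    obtain ⟨v, hv⟩ := (Module.End.hasEigenvalue_iff_isRoot.2 h).exists_hasEigenvector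
    exact hv.2 (hA (by simpa using hv.apply_eq_smul))
  obtain ⟨p, c, hp⟩ := exists_dvd_sq_sub_X h2
    (minpoly.ne_zero (Algebra.IsIntegral.isIntegral (R := K) A)) h0
  refine ⟨p, ?_⟩
  have := congrArg (aeval A) hp
  simpa [sub_eq_zero] using this

theorem exists_isCompl_ker_range {K V : Type*} [Field K] [AddCommGroup V] [Module K V]
    (N : Module.End K V) : ∃ W U : Submodule K V, IsCompl W U ∧ W ≤ LinearMap.ker N ∧
      LinearMap.range N ≤ U ∧ U ⊓ LinearMap.ker N ≤ LinearMap.range N ∧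
      Disjoint (LinearMap.range N ⊓ LinearMap.ker N) W ∧
      (LinearMap.range N ⊓ LinearMap.ker N) ⊔ W = LinearMap.ker N := by
  obtain ⟨W, hd, hs⟩ := IsModularLattice.exists_disjoint_and_sup_eq
    (inf_le_right : LinearMap.range N ⊓ LinearMap.ker N ≤ LinearMap.ker N)
  have hW : W ≤ LinearMap.ker N := hs ▸ le_sup_right
  have hRW : Disjoint (LinearMap.range N) W := by
    rw [disjoint_iff_inf_le] at hd ⊢
    exact fun x hx => hd ⟨⟨hx.1, hW hx.2⟩, hx.2⟩
  obtain ⟨U, hRU, hU⟩ := hRW.exists_isCompl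
  refine ⟨W, U, hU.symm, hW, hRU, ?_, hd, hs⟩
  have : U ⊓ LinearMap.ker N ≤ (LinearMap.range N ⊓ LinearMap.ker N) ⊔ U ⊓ W := by
    conv_lhs => rw [← hs]
    rw [inf_comm, sup_inf_assoc_of_le _ (inf_le_left.trans hRU), inf_comm W]
  rw [hU.inf_eq_bot, sup_bot_eq] at this
  exact this.trans inf_le_left

theorem finrank_range_pow_zero {K V : Type*} [Field K] [AddCommGroup V] [Module K V]
    (N : Module.End K V) :
    Module.finrank K (LinearMap.range (N ^ 0)) = Module.finrank K V := by
  rw [pow_zero, Module.End.one_eq_id, LinearMap.range_id, finrank_top]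

theorem finrank_range_inf_ker {K V : Type*} [Field K] [AddCommGroup V] [Module K V]
    [FiniteDimensional K V] (N : Module.End K V) :
    Module.finrank K (LinearMap.range (N ^ 2)) +
      Module.finrank K (LinearMap.range N ⊓ LinearMap.ker N : Submodule K V) =
      Module.finrank K (LinearMap.range N) := by
  have h := (N.domRestrict (LinearMap.range N)).finrank_range_add_finrank_ker
  rwa [LinearMap.range_domRestrict, LinearMap.ker_domRestrict,
    ← Submodule.finrank_map_subtype_eq, Submodule.map_comap_subtype, ← LinearMap.range_comp,
    ← Module.End.mul_eq_comp, ← sq] at h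

theorem finrank_range_restrict_pow {K V : Type*} [Field K] [AddCommGroup V] [Module K V]
    (N : Module.End K V) (k : ℕ) :
    Module.finrank K (LinearMap.range
      ((N.restrict (p := LinearMap.range N) (q := LinearMap.range N)
        fun x _ => LinearMap.mem_range_self N x) ^ k)) =
      Module.finrank K (LinearMap.range (N ^ (k + 1))) := by
  rw [Module.End.pow_restrict, ← Submodule.finrank_map_subtype_eq, ← LinearMap.range_comp,
    LinearMap.subtype_comp_restrict, LinearMap.range_domRestrict, ← LinearMap.range_comp, pow_succ]
  rfl

theorem exists_linearMap_extension {K V W : Type*} [Field K] [AddCommGroup V] [Module K V]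
    [AddCommGroup W] [Module K W] (N : Module.End K V) (M : Module.End K W)
    (φ : LinearMap.range N →ₗ[K] LinearMap.range M)
    (hφ : ∀ x : LinearMap.range N, (φ ⟨N x, LinearMap.mem_range_self N x⟩ : W) = M (φ x)) :
    ∃ h : V →ₗ[K] W, (∀ x : LinearMap.range N, h x = φ x) ∧
      ∀ v, M (h v) = φ ⟨N v, LinearMap.mem_range_self N v⟩ := by
  obtain ⟨L, hL⟩ := Module.projective_lifting_property M.rangeRestrict (φ ∘ₗ N.rangeRestrict)
    M.surjective_rangeRestrict
  have hL' (v : V) : M (L v) = φ ⟨N v, LinearMap.mem_range_self N v⟩ :=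
    congrArg Subtype.val (LinearMap.congr_fun hL v)
  obtain ⟨E, hE⟩ := LinearMap.exists_extend
    (((LinearMap.range M).subtype ∘ₗ φ - L.domRestrict (LinearMap.range N)).codRestrict
      (LinearMap.ker M) fun x => by simp [hL', hφ])
  have hE' (x : LinearMap.range N) : (E x : W) = φ x - L x :=
    congrArg Subtype.val (LinearMap.congr_fun hE x)
  refine ⟨L + (LinearMap.ker M).subtype ∘ₗ E, fun x => ?_, fun v => ?_⟩
  · simp [hE']
  · simp [hL', LinearMap.mem_ker.1 (E v).2]

theorem exists_linearEquiv_extension {K V W : Type*} [Field K]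
    [AddCommGroup V] [Module K V] [FiniteDimensional K V]
    [AddCommGroup W] [Module K W] [FiniteDimensional K W]
    (N : Module.End K V) (M : Module.End K W)
    (hr : ∀ k, Module.finrank K (LinearMap.range (N ^ k)) =
      Module.finrank K (LinearMap.range (M ^ k)))
    (φ : LinearMap.range N ≃ₗ[K] LinearMap.range M)
    (hφ : ∀ x : LinearMap.range N, (φ ⟨N x, LinearMap.mem_range_self N x⟩ : W) = M (φ x)) :
    ∃ g : V ≃ₗ[K] W, ∀ v, g (N v) = M (g v) := by
  have hVW : Module.finrank K V = Module.finrank K W := by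
    rw [← finrank_range_pow_zero N, hr, finrank_range_pow_zero]
  obtain ⟨h, hhφ, hh⟩ := exists_linearMap_extension N M φ.toLinearMap hφ
  simp only [LinearEquiv.coe_coe] at hhφ hh
  obtain ⟨A, U, hAU, hA, hRU, hU, hd, hs⟩ := exists_isCompl_ker_range N
  obtain ⟨A', U', hAU', hA', hRU', -, hd', hs'⟩ := exists_isCompl_ker_range M
  have hfin : Module.finrank K A = Module.finrank K A' := by
    have h1 := Submodule.finrank_sup_add_finrank_inf_eq (LinearMap.range N ⊓ LinearMap.ker N) A
    have h2 := Submodule.finrank_sup_add_finrank_inf_eq (LinearMap.range M ⊓ LinearMap.ker M) A'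
    rw [hs, hd.eq_bot, finrank_bot] at h1
    rw [hs', hd'.eq_bot, finrank_bot] at h2
    have h3 := finrank_range_inf_ker N
    have h4 := finrank_range_inf_ker M
    have h5 := N.finrank_range_add_finrank_ker
    have h6 := M.finrank_range_add_finrank_ker
    have h7 := hr 1
    have h8 := hr 2
    rw [pow_one, pow_one] at h7
    omega
  let ψ : A ≃ₗ[K] A' := LinearEquiv.ofFinrankEq A A' hfin
  let g : V →ₗ[K] W := LinearMap.ofIsCompl hAU (A'.subtype ∘ₗ ψ) (h.domRestrict U)
  have hgA (a : A) : g a = ψ a := LinearMap.ofIsCompl_apply_left hAU a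
  have hgU (u : U) : g u = h u := LinearMap.ofIsCompl_apply_right hAU u
  have hgN (v : V) : g (N v) = φ ⟨N v, LinearMap.mem_range_self N v⟩ := by
    rw [← hhφ]
    exact hgU ⟨N v, hRU (LinearMap.mem_range_self N v)⟩
  have hMg (v : V) : g (N v) = M (g v) := by
    obtain ⟨a, u, rfl⟩ : ∃ (a : A) (u : U), (a + u : V) = v := by
      obtain ⟨a, ha, u, hu, rfl⟩ := Submodule.mem_sup.1 (hAU.sup_eq_top ▸ Submodule.mem_top (x := v))
      exact ⟨⟨a, ha⟩, ⟨u, hu⟩, rfl⟩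
    have ha : N a = 0 := hA a.2
    have ha' : M (ψ a) = 0 := hA' (ψ a).2
    rw [map_add N, ha, zero_add, map_add g, map_add M, hgA, ha', zero_add, hgU, hh, hgN]
  have hinj : Function.Injective g := by
    rw [← LinearMap.ker_eq_bot, LinearMap.ker_eq_bot']
    intro v hv
    have hNv : N v = 0 := by
      have := hMg v
      rw [hv, map_zero, hgN] at this
      simpa using this
    obtain ⟨a, ha, u, hu, rfl⟩ := Submodule.mem_sup.1 (hAU.sup_eq_top ▸ Submodule.mem_top (x := v))
    have hNu : N u = 0 := by rwa [map_add, (hA ha : N a = 0), zero_add] at hNv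
    have huR : u ∈ LinearMap.range N := hU ⟨hu, hNu⟩
    have hsum : (ψ ⟨a, ha⟩ : W) + φ ⟨u, huR⟩ = 0 := by
      rw [← hv, map_add, ← hgA, ← hhφ]
      exact congrArg _ (hgU ⟨u, hu⟩).symm
    have hψ : (ψ ⟨a, ha⟩ : W) = 0 := by
      refine Submodule.disjoint_def.1 hAU'.disjoint _ (ψ _).2 ?_
      rw [eq_neg_of_add_eq_zero_left hsum]
      exact U'.neg_mem (hRU' (φ _).2)
    rw [hψ, zero_add] at hsum
    have ha0 : a = 0 := by simpa using hψ
    have hu0 : u = 0 := by simpa using hsum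
    rw [ha0, hu0, add_zero]
  exact ⟨LinearEquiv.ofInjectiveOfFinrankEq g hinj hVW, hMg⟩

theorem IsNilpotent.exists_linearEquiv_of_finrank_range_pow_eq {K V W : Type*} [Field K]
    [AddCommGroup V] [Module K V] [FiniteDimensional K V]
    [AddCommGroup W] [Module K W] [FiniteDimensional K W]
    {N : Module.End K V} (hN : IsNilpotent N) (M : Module.End K W)
    (hr : ∀ k, Module.finrank K (LinearMap.range (N ^ k)) =
      Module.finrank K (LinearMap.range (M ^ k))) :
    ∃ g : V ≃ₗ[K] W, ∀ v, g (N v) = M (g v) := by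
  induction hn : Module.finrank K V using Nat.strong_induction_on generalizing V W with
  | _ n ih =>
  subst hn
  rcases subsingleton_or_nontrivial V with hV | hV
  · have hVW : Module.finrank K V = Module.finrank K W := by
      rw [← finrank_range_pow_zero N, hr, finrank_range_pow_zero]
    have g := LinearEquiv.ofFinrankEq V W hVW
    have := g.symm.injective.subsingleton
    exact ⟨g, fun v => Subsingleton.elim _ _⟩
  let N' := N.restrict (p := LinearMap.range N) (q := LinearMap.range N)
    fun x _ => LinearMap.mem_range_self N x
  let M' := M.restrict (p := LinearMap.range M) (q := LinearMap.range M)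
    fun x _ => LinearMap.mem_range_self M x
  have hlt : Module.finrank K (LinearMap.range N) < Module.finrank K V := by
    refine Submodule.finrank_lt fun htop => ?_
    obtain ⟨k, hk⟩ := hN
    have hsurj := (LinearMap.range_eq_top.1 htop).iterate k
    rw [← Module.End.coe_pow, hk] at hsurj
    obtain ⟨v, hv⟩ := exists_ne (0 : V)
    obtain ⟨w, hw⟩ := hsurj v
    exact hv (by simpa using hw.symm)
  have hN' : IsNilpotent N' := by
    obtain ⟨k, hk⟩ := hN
    refine ⟨k, ?_⟩
    rw [Module.End.pow_restrict]
    ext x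
    simp [hk]
  obtain ⟨φ, hφ⟩ := ih _ hlt hN' M' (fun k => by
    rw [finrank_range_restrict_pow, finrank_range_restrict_pow, hr]) rfl
  exact exists_linearEquiv_extension N M hr φ fun x => congrArg Subtype.val (hφ x)

open Polynomial in
theorem LinearMap.apply_aeval_of_selfAdjoint {K V : Type*} [Field K] [AddCommGroup V] [Module K V]
    (Q : V →ₗ[K] V →ₗ[K] K) {A : Module.End K V} (hA : ∀ u v, Q (A u) v = Q u (A v))
    (p : K[X]) (u v : V) : Q (aeval A p u) v = Q u (aeval A p v) := by
  induction p using Polynomial.induction_on' generalizing u v with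
  | add p q hp hq => simp [hp, hq]
  | monomial n c =>
    have (n : ℕ) : Q ((A ^ n) u) v = Q u ((A ^ n) v) := by
      induction n generalizing u v with
      | zero => rfl
      | succ n ih =>
        rw [pow_succ, Module.End.mul_apply, ih, hA, ← Module.End.mul_apply, ← pow_succ', pow_succ]
    simp [aeval_monomial, this]

/-- Two invariant nondegenerate skew forms for the same operator differ by an automorphism
commuting with it. -/
theorem exists_commute_isometry {K V : Type*} [Field K] [IsAlgClosed K] (h2 : (2 : K) ≠ 0)
    [AddCommGroup V] [Module K V] [FiniteDimensional K V] {Q Q' : V →ₗ[K] V →ₗ[K] K}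
    (hQ : ∀ u, (∀ v, Q u v = 0) → u = 0) (hQ' : ∀ u, (∀ v, Q' u v = 0) → u = 0)
    (hskew : ∀ u v, Q u v = -Q v u) (hskew' : ∀ u v, Q' u v = -Q' v u)
    {N : Module.End K V} (hN : ∀ u v, Q (N u) v + Q u (N v) = 0)
    (hN' : ∀ u v, Q' (N u) v + Q' u (N v) = 0) :
    ∃ s : V ≃ₗ[K] V, (∀ u v, Q (s u) (s v) = Q' u v) ∧ ∀ v, s (N v) = N (s v) := by
  have hinjQ : Function.Injective Q := by
    rw [← LinearMap.ker_eq_bot, LinearMap.ker_eq_bot']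
    exact fun u hu => hQ u fun v => by simp [hu]
  let e : V ≃ₗ[K] Module.Dual K V :=
    LinearEquiv.ofInjectiveOfFinrankEq Q hinjQ Subspace.dual_finrank_eq.symm
  let A : Module.End K V := e.symm.toLinearMap ∘ₗ Q'
  have hA (u v : V) : Q (A u) v = Q' u v := LinearMap.congr_fun (e.apply_symm_apply (Q' u)) v
  have hAself (u v : V) : Q (A u) v = Q u (A v) := by
    rw [hA, hskew', ← hA, ← hskew]
  have hAN : Commute A N := by
    refine LinearMap.ext fun u => hinjQ (LinearMap.ext fun v => ?_)
    rw [Module.End.mul_apply, Module.End.mul_apply, hA, eq_neg_of_add_eq_zero_left (hN' u v),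
      eq_neg_of_add_eq_zero_left (hN (A u) v), hA]
  have hAinj : Function.Injective A := by
    rw [← LinearMap.ker_eq_bot, LinearMap.ker_eq_bot']
    exact fun u hu => hQ' u fun v => by simp [← hA, hu]
  obtain ⟨p, hp⟩ := Module.End.exists_aeval_sq_eq h2 hAinj
  have hpA (v : V) : Polynomial.aeval A p (Polynomial.aeval A p v) = A v := by
    rw [← Module.End.mul_apply, ← sq, hp]
  have hpinj : Function.Injective (Polynomial.aeval A p) := fun x y hxy =>
    hAinj (by rw [← hpA, hxy, hpA])
  have hpN : Commute (Polynomial.aeval A p) N :=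
    (Algebra.commute_of_mem_adjoin_singleton_of_commute (Polynomial.aeval_mem_adjoin_singleton K A)
      hAN.symm).symm
  refine ⟨LinearEquiv.ofInjectiveEndo _ hpinj, fun u v => ?_, fun v => ?_⟩
  · simp [← Q.apply_aeval_of_selfAdjoint hAself, hpA, hA]
  · simpa using LinearMap.congr_fun hpN v

/-- For a nondegenerate skew-symmetric (alternating) bilinear form `Q` on a
finite-dimensional complex vector space `V`, two nilpotent infinitesimal isometries `N₁, N₂`
of `Q` are conjugate by an element of `Aut(V, Q)` if and only if `rank (N₁^k) = rank (N₂^k)`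
for every `k ≥ 1`: the `Ad Aut(V,Q)`-orbits of nilpotent elements of the symplectic Lie
algebra are classified by the Jordan partition. -/
theorem stmt1 {V : Type} [AddCommGroup V] [Module ℂ V] [FiniteDimensional ℂ V]
    (Q : V →ₗ[ℂ] V →ₗ[ℂ] ℂ)
    (hQnd : ∀ u : V, (∀ v : V, Q u v = 0) → u = 0)
    (hQskew : ∀ u v : V, Q u v = - Q v u)
    (N₁ N₂ : Module.End ℂ V)
    (hN₁nil : IsNilpotent N₁) (hN₂nil : IsNilpotent N₂)
    (hN₁iso : ∀ u v : V, Q (N₁ u) v + Q u (N₁ v) = 0)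
    (hN₂iso : ∀ u v : V, Q (N₂ u) v + Q u (N₂ v) = 0) :
    (∃ g : V ≃ₗ[ℂ] V, (∀ u v : V, Q (g u) (g v) = Q u v) ∧
        (g : V →ₗ[ℂ] V) ∘ₗ N₁ ∘ₗ (g.symm : V →ₗ[ℂ] V) = N₂) ↔
      (∀ k : ℕ, 1 ≤ k →
        Module.finrank ℂ (LinearMap.range (N₁ ^ k)) =
          Module.finrank ℂ (LinearMap.range (N₂ ^ k))) := by

  constructor
  · rintro ⟨g, -, hg⟩ k -
    have hg' : N₂ = g.conj N₁ := by rw [← hg]; rfl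
    have hpow : N₂ ^ k = g.conj (N₁ ^ k) := by
      rw [hg']; exact (map_pow g.conjRingEquiv N₁ k).symm
    rw [hpow, LinearEquiv.conj_apply, LinearMap.range_comp_of_range_eq_top _ g.symm.range,
      LinearMap.range_comp]
    exact (g.finrank_map_eq _).symm
  · intro hr
    obtain ⟨h, hh⟩ := hN₁nil.exists_linearEquiv_of_finrank_range_pow_eq N₂ fun k => by
      rcases Nat.eq_zero_or_pos k with rfl | hk
      · rw [finrank_range_pow_zero, finrank_range_pow_zero]
      · exact hr k hk
    have hh' (v : V) : h.symm (N₂ v) = N₁ (h.symm v) := by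
      rw [LinearEquiv.symm_apply_eq, hh, LinearEquiv.apply_symm_apply]
    obtain ⟨s, hs, hsN⟩ := exists_commute_isometry (two_ne_zero' ℂ)
      (Q := Q) (Q' := Q.compl₁₂ h.symm.toLinearMap h.symm.toLinearMap) (N := N₂) hQnd
      (fun u hu => by
        have := hQnd (h.symm u) fun v => by simpa using hu (h v)
        simpa using this)
      hQskew (fun u v => by simpa using hQskew _ _) hN₂iso
      (fun u v => by simpa [hh'] using hN₁iso _ _)
    refine ⟨h.trans s, fun u v => ?_, ?_⟩
    · simpa using hs (h u) (h v)
    · ext v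
      simp [hh, hsN]
end

section
/- Let N be a nilpotent infinitesimal isometry of Q. For d ≥ 1 the number of Jordan blocks of N of size d equals m_d = rank(N^{d−1}) − 2·rank(N^d) + rank(N^{d+1}) (with N⁰ = id). Then m_d is even for every odd integer d ≥ 1; that is, the odd parts of the Jordan partition of a nilpotent element of the symplectic Lie algebra occur with even multiplicity. -/
/-- A nondegenerate skew-symmetric bilinear form over a field of characteristic different from two
lives on an even-dimensional space. -/
theorem even_finrank_of_nondegenerate_of_skew {K W : Type*} [Field K] [AddCommGroup W] [Module K W]
    [FiniteDimensional K W] (h2 : (2 : K) ≠ 0) (B : W →ₗ[K] W →ₗ[K] K)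
    (hB : B.Nondegenerate) (hskew : ∀ u v : W, B u v = - B v u) :
    Even (Module.finrank K W) := by
  let b := Module.finBasis K W
  have hdet := (LinearMap.nondegenerate_iff_det_ne_zero b).1 hB
  have hneg : (LinearMap.toMatrix₂ b b B).transpose = - LinearMap.toMatrix₂ b b B := by
    ext i j
    simpa [LinearMap.toMatrix₂_apply] using hskew (b j) (b i)
  by_contra hodd
  rw [Nat.not_even_iff_odd] at hodd
  have h := congrArg Matrix.det hneg
  rw [Matrix.det_transpose, Matrix.det_neg, Fintype.card_fin, hodd.neg_one_pow] at h
  have h' : (2 : K) * (LinearMap.toMatrix₂ b b B).det = 0 := by linear_combination h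
  exact (mul_ne_zero h2 hdet) h'

/-- A skew-symmetric bilinear form over a field of characteristic different from two has even
rank. -/
theorem even_finrank_range_of_skew {K V : Type*} [Field K] [AddCommGroup V] [Module K V]
    [FiniteDimensional K V] (h2 : (2 : K) ≠ 0) (B : V →ₗ[K] V →ₗ[K] K)
    (hskew : ∀ u v : V, B u v = - B v u) :
    Even (Module.finrank K (LinearMap.range B)) := by
  obtain ⟨W, hW⟩ := Submodule.exists_isCompl (LinearMap.ker B)
  have hrefl : (B.domRestrict₁₂ W W).IsRefl := fun x y hxy =>
    (hskew y x).trans (neg_eq_zero.2 hxy)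
  have hnd : (B.domRestrict₁₂ W W).Nondegenerate := by
    refine hrefl.nondegenerate_iff_separatingLeft.2 fun x hx => ?_
    have hker : (x : V) ∈ LinearMap.ker B := by
      rw [LinearMap.mem_ker]
      ext v
      obtain ⟨k, hk, w, hw, rfl⟩ := Submodule.mem_sup.1 (hW.sup_eq_top ▸ Submodule.mem_top (x := v))
      have hxw : B x w = 0 := hx ⟨w, hw⟩
      rw [map_add, hskew x k, LinearMap.mem_ker.1 hk, hxw]
      simp
    exact Subtype.ext (Submodule.disjoint_def.1 hW.disjoint _ hker x.2)
  have hWeven := even_finrank_of_nondegenerate_of_skew h2 _ hnd fun u v => hskew u v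
  have h₁ := Submodule.finrank_add_eq_of_isCompl hW
  have h₂ := B.finrank_range_add_finrank_ker
  rwa [show Module.finrank K (LinearMap.range B) = Module.finrank K W by omega]

/-- Even powers of an infinitesimal isometry of a nondegenerate skew-symmetric form have even
rank. -/
theorem even_finrank_range_pow_of_skew {K V : Type*} [Field K] [AddCommGroup V] [Module K V]
    [FiniteDimensional K V] (h2 : (2 : K) ≠ 0) (Q : V →ₗ[K] V →ₗ[K] K)
    (hQnd : ∀ u : V, (∀ v : V, Q u v = 0) → u = 0)
    (hQskew : ∀ u v : V, Q u v = - Q v u) (N : Module.End K V)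
    (hNiso : ∀ u v : V, Q (N u) v + Q u (N v) = 0) {k : ℕ} (hk : Even k) :
    Even (Module.finrank K (LinearMap.range (N ^ k))) := by
  have hpow : ∀ (n : ℕ) (u v : V), Q ((N ^ n) u) v = (-1) ^ n * Q u ((N ^ n) v) := by
    intro n
    induction n with
    | zero => simp
    | succ n ih =>
      intro u v
      have hl : (N ^ (n + 1)) u = (N ^ n) (N u) := by rw [pow_succ, Module.End.mul_apply]
      have hr : (N ^ (n + 1)) v = N ((N ^ n) v) := by rw [pow_succ', Module.End.mul_apply]
      rw [hl, hr, ih]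
      linear_combination (-1) ^ n * hNiso u ((N ^ n) v)
  have hQker : LinearMap.ker Q = ⊥ := by
    refine LinearMap.ker_eq_bot'.2 fun u hu => hQnd u fun v => ?_
    rw [hu, LinearMap.zero_apply]
  have heven := even_finrank_range_of_skew h2 (Q ∘ₗ (N ^ k)) fun u v => by
    rw [LinearMap.comp_apply, LinearMap.comp_apply, hpow, hk.neg_one_pow, one_mul, hQskew]
  have h₁ := (Q ∘ₗ (N ^ k)).finrank_range_add_finrank_ker
  have h₂ := (N ^ k).finrank_range_add_finrank_ker
  rw [LinearMap.ker_comp_of_ker_eq_bot _ hQker] at h₁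
  rwa [show Module.finrank K (LinearMap.range (N ^ k)) =
    Module.finrank K (LinearMap.range (Q ∘ₗ (N ^ k))) by omega]


/-- Let `Q` be a nondegenerate skew-symmetric bilinear form on a
finite-dimensional complex vector space and `N` a nilpotent infinitesimal isometry of `Q`.
For `d ≥ 1` the number of Jordan blocks of `N` of size `d` is
`m_d = rank (N^(d-1)) - 2 rank (N^d) + rank (N^(d+1))` (with `N^0 = id`).  Then `m_d` is even
for every odd `d ≥ 1`: odd parts of the Jordan partition of a nilpotent element of the
symplectic Lie algebra occur with even multiplicity. -/
theorem stmt2 {V : Type} [AddCommGroup V] [Module ℂ V] [FiniteDimensional ℂ V]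
    (Q : V →ₗ[ℂ] V →ₗ[ℂ] ℂ)
    (hQnd : ∀ u : V, (∀ v : V, Q u v = 0) → u = 0)
    (hQskew : ∀ u v : V, Q u v = - Q v u)
    (N : Module.End ℂ V)
    (hNnil : IsNilpotent N)
    (hNiso : ∀ u v : V, Q (N u) v + Q u (N v) = 0)
    (d : ℕ) (hd : 1 ≤ d) (hodd : Odd d) :
    Even ((Module.finrank ℂ (LinearMap.range (N ^ (d - 1))) : ℤ)
      - 2 * (Module.finrank ℂ (LinearMap.range (N ^ d)) : ℤ)
      + (Module.finrank ℂ (LinearMap.range (N ^ (d + 1))) : ℤ)) := by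
  have hrank {k : ℕ} (hk : Even k) :
      Even (Module.finrank ℂ (LinearMap.range (N ^ k)) : ℤ) :=
    (Int.even_coe_nat _).2
      (even_finrank_range_pow_of_skew two_ne_zero Q hQnd hQskew N hNiso hk)
  exact ((hrank (Nat.Odd.sub_odd hodd odd_one)).sub (even_two_mul _)).add
    (hrank hodd.add_one)
end

section
/- Let N₁ and N₂ be nilpotent infinitesimal isometries of Q. Then there exists g ∈ Aut(V, Q) with g ∘ N₁ ∘ g⁻¹ = N₂ if and only if for every integer ℓ ≥ 0 the following hold: rank(N₁^ℓ) = rank(N₂^ℓ), and there exists a linear isomorphism φ : ker(N₁^{ℓ+1}) → ker(N₂^{ℓ+1}) with Q(φu, N₂^ℓ(φu)) = Q(u, N₁^ℓ u) for all u ∈ ker(N₁^{ℓ+1}). (This expresses the classification of real symplectic nilpotent orbits by signed Young diagrams: the signatures of the induced quadratic forms u ↦ Q(u, N^ℓ u) on ker(N^{ℓ+1}) together with the ranks of the powers of N form a complete set of invariants.) -/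
section AlternatingForms

variable {K K₁ K₂ : Type*} [AddCommGroup K] [Module ℝ K] [AddCommGroup K₁] [Module ℝ K₁]
  [AddCommGroup K₂] [Module ℝ K₂]

/-- Projection along the plane spanned by a hyperbolic pair `e, f` of `B`. -/
def hyperbolicProj (B : K →ₗ[ℝ] K →ₗ[ℝ] ℝ) (e f : K) : K →ₗ[ℝ] K :=
  LinearMap.id - (B.flip f).smulRight e + (B.flip e).smulRight f

lemma hyperbolicProj_apply (B : K →ₗ[ℝ] K →ₗ[ℝ] ℝ) (e f x : K) :
    hyperbolicProj B e f x = x - B x f • e + B x e • f := rfl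

lemma compl₁₂_hyperbolicProj_apply {B : K →ₗ[ℝ] K →ₗ[ℝ] ℝ} (hB : ∀ x y, B x y = -B y x)
    {e f : K} (hef : B e f = 1) (x y : K) :
    B (hyperbolicProj B e f x) (hyperbolicProj B e f y) =
      B x y + B x f * B y e - B x e * B y f := by
  have he : B e e = 0 := by linarith [hB e e]
  have hf : B f f = 0 := by linarith [hB f f]
  have hfe : B f e = -1 := by rw [hB, hef]
  simp only [hyperbolicProj_apply, map_add, map_sub, map_smul, LinearMap.add_apply,
    LinearMap.sub_apply, LinearMap.smul_apply, smul_eq_mul, he, hf, hfe, hef]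
  rw [hB e y, hB f y]
  ring

/-- Splitting off a hyperbolic pair lowers the rank of a skew form by at least two. -/
lemma finrank_range_compl₁₂_hyperbolicProj_add_two_le [FiniteDimensional ℝ K]
    {B : K →ₗ[ℝ] K →ₗ[ℝ] ℝ} (hB : ∀ x y, B x y = -B y x) {e f : K} (hef : B e f = 1) :
    Module.finrank ℝ (LinearMap.range
      (B.compl₁₂ (hyperbolicProj B e f) (hyperbolicProj B e f))) + 2 ≤
      Module.finrank ℝ (LinearMap.range B) := by
  have he : B e e = 0 := by linarith [hB e e]
  have hf : B f f = 0 := by linarith [hB f f]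
  have hfe : B f e = -1 := by rw [hB, hef]
  let ev : LinearMap.range B →ₗ[ℝ] ℝ × ℝ :=
    ((LinearMap.applyₗ (R := ℝ) e).prod (LinearMap.applyₗ (R := ℝ) f)).comp
      (LinearMap.range B).subtype
  have hsurj : Function.Surjective ev := by
    rintro ⟨a, b⟩
    refine ⟨⟨B (b • e - a • f), LinearMap.mem_range_self _ _⟩, ?_⟩
    simp [ev, he, hf, hfe, hef]
  have hle : LinearMap.range (B.compl₁₂ (hyperbolicProj B e f) (hyperbolicProj B e f)) ≤
      (LinearMap.ker ev).map (LinearMap.range B).subtype := by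
    rintro _ ⟨x, rfl⟩
    have hx : B.compl₁₂ (hyperbolicProj B e f) (hyperbolicProj B e f) x =
        B (hyperbolicProj B e f x) := by
      ext y
      rw [LinearMap.compl₁₂_apply, compl₁₂_hyperbolicProj_apply hB hef]
      simp only [hyperbolicProj_apply, map_add, map_sub, map_smul, LinearMap.add_apply,
        LinearMap.sub_apply, LinearMap.smul_apply, smul_eq_mul]
      rw [hB e y, hB f y]
      ring
    refine ⟨⟨_, LinearMap.mem_range_self B (hyperbolicProj B e f x)⟩, ?_, hx.symm⟩
    simp [ev, hyperbolicProj_apply, he, hf, hfe, hef]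
  have h1 := Submodule.finrank_mono hle
  rw [Submodule.finrank_map_subtype_eq] at h1
  have h2 := LinearMap.finrank_range_add_finrank_ker (K := ℝ) (V := LinearMap.range B) ev
  rw [LinearMap.range_eq_top.2 hsurj, finrank_top, Module.finrank_prod, Module.finrank_self] at h2
  omega

/-- Splitting off a hyperbolic pair lowers the rank of a skew form by at most two. -/
lemma finrank_range_le_compl₁₂_hyperbolicProj_add_two [FiniteDimensional ℝ K]
    {B : K →ₗ[ℝ] K →ₗ[ℝ] ℝ} (hB : ∀ x y, B x y = -B y x) {e f : K} (hef : B e f = 1) :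
    Module.finrank ℝ (LinearMap.range B) ≤ Module.finrank ℝ (LinearMap.range
      (B.compl₁₂ (hyperbolicProj B e f) (hyperbolicProj B e f))) + 2 := by
  set B' := B.compl₁₂ (hyperbolicProj B e f) (hyperbolicProj B e f)
  have hle : LinearMap.range B ≤ LinearMap.range B' ⊔ Submodule.span ℝ {B e, B f} := by
    rintro _ ⟨x, rfl⟩
    have hx : B x = B' x + (B x f • B e - B x e • B f) := by
      ext y
      simp only [B', LinearMap.add_apply, LinearMap.sub_apply, LinearMap.smul_apply, smul_eq_mul]
      rw [LinearMap.compl₁₂_apply, compl₁₂_hyperbolicProj_apply hB hef, hB e y, hB f y]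
      ring
    rw [hx]
    refine Submodule.add_mem_sup (LinearMap.mem_range_self _ _) (Submodule.sub_mem _ ?_ ?_) <;>
      exact Submodule.smul_mem _ _ (Submodule.subset_span (by simp))
  have hspan : Module.finrank ℝ (Submodule.span ℝ {B e, B f}) ≤ 2 := by
    classical
    have := finrank_span_finset_le_card (R := ℝ) ({B e, B f} : Finset (K →ₗ[ℝ] ℝ))
    simp only [Finset.coe_insert, Finset.coe_singleton] at this
    exact this.trans Finset.card_le_two
  have := (Submodule.finrank_mono hle).trans (Submodule.finrank_add_le_finrank_add_finrank _ _)
  omega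

lemma exists_apply_eq_one {B : K →ₗ[ℝ] K →ₗ[ℝ] ℝ} (hB : B ≠ 0) : ∃ e f, B e f = 1 := by
  obtain ⟨e, he⟩ := DFunLike.ne_iff.1 hB
  obtain ⟨f, hf⟩ := DFunLike.ne_iff.1 he
  exact ⟨e, (B e f)⁻¹ • f, by simpa using inv_mul_cancel₀ hf⟩

/-- A skew form maps isometrically to any skew form of at least the same rank. -/
lemma exists_preserving_of_finrank_range_le [FiniteDimensional ℝ K₁] [FiniteDimensional ℝ K₂]
    (B₁ : K₁ →ₗ[ℝ] K₁ →ₗ[ℝ] ℝ) (B₂ : K₂ →ₗ[ℝ] K₂ →ₗ[ℝ] ℝ)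
    (h₁ : ∀ x y, B₁ x y = -B₁ y x) (h₂ : ∀ x y, B₂ x y = -B₂ y x)
    (hle : Module.finrank ℝ (LinearMap.range B₁) ≤ Module.finrank ℝ (LinearMap.range B₂)) :
    ∃ φ : K₁ →ₗ[ℝ] K₂, ∀ x y, B₂ (φ x) (φ y) = B₁ x y := by
  induction hn : Module.finrank ℝ (LinearMap.range B₁) using Nat.strong_induction_on
    generalizing B₁ B₂ with
  | _ n ih =>
  by_cases hB₁ : B₁ = 0
  · exact ⟨0, by simp [hB₁]⟩
  obtain ⟨e, f, hef⟩ := exists_apply_eq_one hB₁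
  have hrank₁ := finrank_range_compl₁₂_hyperbolicProj_add_two_le h₁ hef
  have hB₂ : B₂ ≠ 0 := by
    rintro rfl
    rw [LinearMap.range_zero, finrank_bot] at hle
    omega
  obtain ⟨e', f', hef'⟩ := exists_apply_eq_one hB₂
  have hrank₂ := finrank_range_le_compl₁₂_hyperbolicProj_add_two h₂ hef'
  obtain ⟨φ, hφ⟩ := ih _ (by omega)
    (B₁.compl₁₂ (hyperbolicProj B₁ e f) (hyperbolicProj B₁ e f))
    (B₂.compl₁₂ (hyperbolicProj B₂ e' f') (hyperbolicProj B₂ e' f'))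
    (fun x y => h₁ _ _) (fun x y => h₂ _ _) (by omega) rfl
  refine ⟨(hyperbolicProj B₂ e' f').comp φ + (B₁.flip f).smulRight e' -
    (B₁.flip e).smulRight f', fun x y => ?_⟩
  have he' : B₂ e' e' = 0 := by linarith [h₂ e' e']
  have hf' : B₂ f' f' = 0 := by linarith [h₂ f' f']
  have hfe' : B₂ f' e' = -1 := by rw [h₂, hef']
  have hPe (z) : B₂ (hyperbolicProj B₂ e' f' z) e' = 0 := by
    simp [hyperbolicProj_apply, he', hfe']
  have hPf (z) : B₂ (hyperbolicProj B₂ e' f' z) f' = 0 := by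
    simp [hyperbolicProj_apply, hf', hef']
  have hxy := hφ x y
  rw [LinearMap.compl₁₂_apply, LinearMap.compl₁₂_apply,
    compl₁₂_hyperbolicProj_apply h₁ hef] at hxy
  simp only [LinearMap.add_apply, LinearMap.sub_apply, LinearMap.comp_apply,
    LinearMap.smulRight_apply, LinearMap.flip_apply, map_add, map_sub, map_smul,
    LinearMap.smul_apply, smul_eq_mul, hPe, hPf, hxy, he', hf', hfe', hef',
    h₂ e' (hyperbolicProj B₂ e' f' _), h₂ f' (hyperbolicProj B₂ e' f' _)]
  ring

end AlternatingForms

section SkewAdjoint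

variable {V V₁ V₂ : Type*} [AddCommGroup V] [Module ℝ V] [AddCommGroup V₁] [Module ℝ V₁]
  [AddCommGroup V₂] [Module ℝ V₂]

lemma apply_ker_range_eq_zero {Q : V →ₗ[ℝ] V →ₗ[ℝ] ℝ} {N : Module.End ℝ V}
    (hN : ∀ u v, Q (N u) v + Q u (N v) = 0) {u v : V} (hu : N u = 0)
    (hv : v ∈ LinearMap.range N) : Q u v = 0 := by
  obtain ⟨w, rfl⟩ := hv
  simpa [hu] using hN u w

lemma apply_range_ker_eq_zero {Q : V →ₗ[ℝ] V →ₗ[ℝ] ℝ} {N : Module.End ℝ V}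
    (hN : ∀ u v, Q (N u) v + Q u (N v) = 0) {u v : V} (hu : u ∈ LinearMap.range N)
    (hv : N v = 0) : Q u v = 0 := by
  obtain ⟨w, rfl⟩ := hu
  simpa [hv] using hN w v

/-- A skew-adjoint `N` induces on its range the form `(N u, N v) ↦ Q u (N v)`. -/
lemma exists_rangeForm {Q : V →ₗ[ℝ] V →ₗ[ℝ] ℝ} {N : Module.End ℝ V}
    (hN : ∀ u v, Q (N u) v + Q u (N v) = 0) :
    ∃ Q' : LinearMap.range N →ₗ[ℝ] LinearMap.range N →ₗ[ℝ] ℝ,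
      ∀ (u : V) (x y : LinearMap.range N), N u = x → Q' x y = Q u y := by
  obtain ⟨s, hs⟩ := N.rangeRestrict.exists_rightInverse_of_surjective N.range_rangeRestrict
  have hs' (x : LinearMap.range N) : N (s x) = x := congrArg Subtype.val (LinearMap.congr_fun hs x)
  refine ⟨Q.compl₁₂ s (LinearMap.range N).subtype, fun u x y hu => ?_⟩
  have h := apply_ker_range_eq_zero hN (u := s x - u) (by rw [map_sub, hs', hu, sub_self]) y.2
  rw [map_sub, LinearMap.sub_apply, sub_eq_zero] at h
  simpa using h

/-- A nondegenerate form identifies a finite-dimensional space with its dual. -/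
lemma exists_form_equiv_dual [FiniteDimensional ℝ V] {Q : V →ₗ[ℝ] V →ₗ[ℝ] ℝ}
    (hQ : ∀ u, (∀ v, Q u v = 0) → u = 0) :
    ∃ e : V ≃ₗ[ℝ] (V →ₗ[ℝ] ℝ), ∀ u v, e u v = Q u v := by
  have hinj : Function.Injective Q := by
    rw [injective_iff_map_eq_zero]
    exact fun u hu => hQ u fun v => by rw [hu, LinearMap.zero_apply]
  exact ⟨Q.linearEquivOfInjective hinj Subspace.dual_finrank_eq.symm, fun u v => by simp⟩

lemma mem_range_of_forall_ker [FiniteDimensional ℝ V] {Q : V →ₗ[ℝ] V →ₗ[ℝ] ℝ}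
    {N : Module.End ℝ V} (hQ : ∀ u, (∀ v, Q u v = 0) → u = 0)
    (hN : ∀ u v, Q (N u) v + Q u (N v) = 0) {u : V} (hu : ∀ v, N v = 0 → Q u v = 0) :
    u ∈ LinearMap.range N := by
  have hmem : (Q u : Module.Dual ℝ V) ∈ LinearMap.range N.dualMap := by
    rw [LinearMap.range_dualMap_eq_dualAnnihilator_ker, Submodule.mem_dualAnnihilator]
    exact fun v hv => hu v hv
  obtain ⟨g, hg⟩ := hmem
  obtain ⟨e, he⟩ := exists_form_equiv_dual hQ
  refine ⟨-e.symm g, sub_eq_zero.1 (hQ _ fun v => ?_)⟩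
  have h1 : Q (e.symm g) (N v) = Q u v := by
    rw [← he, e.apply_symm_apply, ← hg, LinearMap.dualMap_apply]
  have h2 := hN (e.symm g) v
  simp only [map_neg, map_sub, LinearMap.sub_apply, LinearMap.neg_apply]
  linarith

/-- If a form `P` agrees with `Q` on the range of `N` and on its kernel, then `P` pulls back to `Q`
along some map that is the identity modulo the kernel of `N` and on the range of `N`. -/
lemma exists_correction [FiniteDimensional ℝ V] {Q P : V →ₗ[ℝ] V →ₗ[ℝ] ℝ} {N : Module.End ℝ V}
    {ε : ℝ} (hε : ε * ε = 1) (hQ : ∀ u, (∀ v, Q u v = 0) → u = 0)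
    (hQs : ∀ u v, Q u v = ε * Q v u) (hPs : ∀ u v, P u v = ε * P v u)
    (hN : ∀ u v, Q (N u) v + Q u (N v) = 0)
    (hrange : ∀ u v, P u (N v) = Q u (N v))
    (hker : ∀ u v, N u = 0 → N v = 0 → P u v = Q u v) :
    ∃ S : Module.End ℝ V, (∀ u, N (S u) = N u) ∧ (∀ u, S (N u) = N u) ∧
      ∀ u v, P (S u) (S v) = Q u v := by
  obtain ⟨e, he⟩ := exists_form_equiv_dual hQ
  let E : Module.End ℝ V := e.symm.toLinearMap ∘ₗ (P - Q)
  have hE (u v) : Q (E u) v = P u v - Q u v := by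
    rw [← he]
    simp [E]
  have hNE (u) : N (E u) = 0 := hQ _ fun v => by
    have := hN (E u) v
    rw [hE, hrange] at this
    linarith
  have hEN (u) : E (N u) = 0 := hQ _ fun v => by
    rw [hE, hPs, hQs, hrange, sub_self]
  have hadj (u v) : Q u (E v) = Q (E u) v := by
    rw [hQs, hE, hE, hPs v u, hQs v u]
    linear_combination (P u v - Q u v) * hε
  have hE3 (u) : E (E (E u)) = 0 := by
    obtain ⟨w, hw⟩ := mem_range_of_forall_ker hQ hN (u := E (E u)) fun v hv => by
      rw [hE, hker _ _ (hNE u) hv, sub_self]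
    rw [← hw, hEN]
  have hP (u v) : P u v = Q u v + Q (E u) v := by rw [hE]; ring
  refine ⟨LinearMap.id - (1 / 2 : ℝ) • E + (3 / 8 : ℝ) • E ∘ₗ E, fun u => ?_, fun u => ?_,
    fun u v => ?_⟩
  · simp [hNE]
  · simp [hEN]
  · simp only [hP, LinearMap.add_apply, LinearMap.sub_apply, LinearMap.smul_apply,
      LinearMap.id_apply, LinearMap.comp_apply, map_add, map_sub, map_smul, smul_eq_mul, hadj, hE3,
      map_zero, LinearMap.zero_apply]
    ring

/-- Extend an intertwiner `h'` from `range N₁` to the whole space, with values on the kernel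
of `N₁` prescribed by `f` away from the range. -/
lemma exists_intertwining_extension {N₁ : Module.End ℝ V₁} {N₂ : Module.End ℝ V₂}
    (h' : LinearMap.range N₁ →ₗ[ℝ] LinearMap.range N₂)
    (hh' : ∀ x y : LinearMap.range N₁, N₁ x = y → N₂ (h' x) = h' y)
    (f : V₁ →ₗ[ℝ] V₂) (hf : ∀ u, N₁ u = 0 → N₂ (f u) = 0) :
    ∃ h : V₁ →ₗ[ℝ] V₂, (∀ (u) (x : LinearMap.range N₁), N₁ u = x → N₂ (h u) = h' x) ∧
      (∀ x : LinearMap.range N₁, h x = h' x) ∧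
      ∀ u, N₁ u = 0 → ∃ y : LinearMap.range N₁, N₁ y = 0 ∧ h u = h' y + f (u - y) := by
  obtain ⟨s, hs⟩ := N₂.rangeRestrict.exists_rightInverse_of_surjective N₂.range_rangeRestrict
  have hs' (x : LinearMap.range N₂) : N₂ (s x) = x :=
    congrArg Subtype.val (LinearMap.congr_fun hs x)
  let l : V₁ →ₗ[ℝ] V₂ := s ∘ₗ h' ∘ₗ N₁.rangeRestrict
  have hl (u) (x : LinearMap.range N₁) (hx : N₁ u = x) : N₂ (l u) = h' x := by
    have : N₁.rangeRestrict u = x := Subtype.ext hx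
    simp [l, hs', this]
  let d : LinearMap.range N₁ →ₗ[ℝ] LinearMap.ker N₂ :=
    (l ∘ₗ (LinearMap.range N₁).subtype - (LinearMap.range N₂).subtype ∘ₗ h').codRestrict _
      fun x => by
        have h1 := hl x ⟨N₁ x, LinearMap.mem_range_self _ _⟩ rfl
        have h2 := hh' x ⟨N₁ x, LinearMap.mem_range_self _ _⟩ rfl
        simp [h1, h2]
  obtain ⟨D, hD⟩ := d.exists_extend
  have hD' (x : LinearMap.range N₁) : (D x : V₂) = l x - h' x :=
    congrArg Subtype.val (LinearMap.congr_fun hD x)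
  let h₁ : V₁ →ₗ[ℝ] V₂ := l - (LinearMap.ker N₂).subtype ∘ₗ D
  have hh₁ (u) (x : LinearMap.range N₁) (hx : N₁ u = x) : N₂ (h₁ u) = h' x := by
    have h0 : N₂ (D u) = 0 := (D u).2
    simp [h₁, hl u x hx, h0]
  have hh₁r (x : LinearMap.range N₁) : h₁ x = h' x := by simp [h₁, hD']
  -- a projection of `ker N₁` onto a complement of `ker N₁ ⊓ range N₁`, killing `range N₁`
  let a : LinearMap.ker N₁ →ₗ[ℝ] V₁ ⧸ LinearMap.range N₁ :=
    (LinearMap.range N₁).mkQ ∘ₗ (LinearMap.ker N₁).subtype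
  obtain ⟨t, ht⟩ := a.rangeRestrict.exists_rightInverse_of_surjective a.range_rangeRestrict
  have ht' (x : LinearMap.range a) : a (t x) = x :=
    congrArg Subtype.val (LinearMap.congr_fun ht x)
  obtain ⟨b, hb⟩ := t.exists_extend
  have hab (u : LinearMap.ker N₁) : a (b (a u)) = a u := by
    have h1 : b (a u) = t (a.rangeRestrict u) := LinearMap.congr_fun hb (a.rangeRestrict u)
    rw [h1, ht']
    rfl
  let q : V₁ →ₗ[ℝ] LinearMap.ker N₁ := b ∘ₗ (LinearMap.range N₁).mkQ
  have hqr (x : LinearMap.range N₁) : q x = 0 := by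
    have : (LinearMap.range N₁).mkQ (x : V₁) = 0 := by simp
    simp only [q, LinearMap.comp_apply, this, map_zero]
  have hqk (u) (hu : N₁ u = 0) : u - q u ∈ LinearMap.range N₁ := by
    have h1 := hab ⟨u, hu⟩
    exact (Submodule.Quotient.eq _).1 h1.symm
  have hq0 (u) : N₁ (q u) = 0 := (q u).2
  refine ⟨h₁ + (f - h₁) ∘ₗ (LinearMap.ker N₁).subtype ∘ₗ q, fun u x hx => ?_, fun x => ?_,
    fun u hu => ⟨⟨u - q u, hqk u hu⟩, ?_, ?_⟩⟩
  · have h0 : N₂ (h₁ (q u)) = 0 := by simpa using hh₁ (q u) 0 (hq0 u)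
    simp [hh₁ u x hx, hf _ (hq0 u), h0]
  · simp [hqr, hh₁r]
  · simp [hu, hq0]
  · rw [← hh₁r]
    simp
    abel

lemma finrank_range_restrict_ker [FiniteDimensional ℝ V] {Q : V →ₗ[ℝ] V →ₗ[ℝ] ℝ}
    {N : Module.End ℝ V} (hQ : ∀ u, (∀ v, Q u v = 0) → u = 0)
    (hN : ∀ u v, Q (N u) v + Q u (N v) = 0) :
    Module.finrank ℝ (LinearMap.range
        (Q.compl₁₂ (LinearMap.ker N).subtype (LinearMap.ker N).subtype)) +
      2 * Module.finrank ℝ (LinearMap.range N) =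
      Module.finrank ℝ V + Module.finrank ℝ (LinearMap.range (N ^ 2)) := by
  set B := Q.compl₁₂ (LinearMap.ker N).subtype (LinearMap.ker N).subtype
  have h1 := LinearMap.finrank_range_add_finrank_ker B
  have h2 := LinearMap.finrank_range_add_finrank_ker N
  have h3 := LinearMap.finrank_range_add_finrank_ker (N.domRestrict (LinearMap.range N))
  have h4 : LinearMap.range (N.domRestrict (LinearMap.range N)) = LinearMap.range (N ^ 2) := by
    rw [LinearMap.range_domRestrict, pow_two, Module.End.mul_eq_comp, LinearMap.range_comp]
  have h5 : (LinearMap.ker B).map (LinearMap.ker N).subtype =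
      (LinearMap.ker (N.domRestrict (LinearMap.range N))).map (LinearMap.range N).subtype := by
    ext u
    constructor
    · rintro ⟨⟨v, hv⟩, hvB, rfl⟩
      refine ⟨⟨v, mem_range_of_forall_ker hQ hN fun w hw => ?_⟩, hv, rfl⟩
      exact LinearMap.congr_fun hvB ⟨w, hw⟩
    · rintro ⟨⟨v, hv⟩, hvk, rfl⟩
      refine ⟨⟨v, hvk⟩, ?_, rfl⟩
      ext w
      exact apply_range_ker_eq_zero hN hv w.2
  have h6 := congrArg (fun p : Submodule ℝ V => Module.finrank ℝ p) h5
  simp only [Submodule.finrank_map_subtype_eq] at h6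
  rw [h4] at h3
  omega

/-- A linear map preserving a quadratic form preserves the associated symmetric form. -/
lemma polarization {B₁ : V₁ →ₗ[ℝ] V₁ →ₗ[ℝ] ℝ} {B₂ : V₂ →ₗ[ℝ] V₂ →ₗ[ℝ] ℝ}
    (h₁ : ∀ u v, B₁ u v = B₁ v u) (h₂ : ∀ u v, B₂ u v = B₂ v u) {φ : V₁ →ₗ[ℝ] V₂}
    {u v : V₁} (hu : B₂ (φ u) (φ u) = B₁ u u) (hv : B₂ (φ v) (φ v) = B₁ v v)
    (huv : B₂ (φ (u + v)) (φ (u + v)) = B₁ (u + v) (u + v)) :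
    B₂ (φ u) (φ v) = B₁ u v := by
  simp only [map_add, LinearMap.add_apply] at huv
  linarith [h₁ u v, h₂ (φ u) (φ v)]

lemma exists_ker_preserving [FiniteDimensional ℝ V₁] [FiniteDimensional ℝ V₂]
    {Q₁ : V₁ →ₗ[ℝ] V₁ →ₗ[ℝ] ℝ} {Q₂ : V₂ →ₗ[ℝ] V₂ →ₗ[ℝ] ℝ} {N₁ : Module.End ℝ V₁}
    {N₂ : Module.End ℝ V₂} {ε : ℝ} (hε : ε * ε = 1)
    (hQ₁ : ∀ u, (∀ v, Q₁ u v = 0) → u = 0) (hQ₂ : ∀ u, (∀ v, Q₂ u v = 0) → u = 0)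
    (hs₁ : ∀ u v, Q₁ u v = ε * Q₁ v u) (hs₂ : ∀ u v, Q₂ u v = ε * Q₂ v u)
    (hN₁ : ∀ u v, Q₁ (N₁ u) v + Q₁ u (N₁ v) = 0) (hN₂ : ∀ u v, Q₂ (N₂ u) v + Q₂ u (N₂ v) = 0)
    (hrank : ∀ ℓ : ℕ, Module.finrank ℝ (LinearMap.range (N₁ ^ ℓ)) =
      Module.finrank ℝ (LinearMap.range (N₂ ^ ℓ)))
    (φ : V₁ →ₗ[ℝ] V₂) (hφ : ∀ u, N₁ u = 0 → N₂ (φ u) = 0 ∧ Q₂ (φ u) (φ u) = Q₁ u u) :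
    ∃ f : V₁ →ₗ[ℝ] V₂, (∀ u, N₁ u = 0 → N₂ (f u) = 0) ∧
      ∀ u v, N₁ u = 0 → N₁ v = 0 → Q₂ (f u) (f v) = Q₁ u v := by
  rcases mul_self_eq_one_iff.1 hε with rfl | rfl
  · refine ⟨φ, fun u hu => (hφ u hu).1, fun u v hu hv => ?_⟩
    exact polarization (by simpa using hs₁) (by simpa using hs₂) (hφ u hu).2 (hφ v hv).2
      (hφ (u + v) (by rw [map_add, hu, hv, add_zero])).2
  · have hr₁ := finrank_range_restrict_ker hQ₁ hN₁
    have hr₂ := finrank_range_restrict_ker hQ₂ hN₂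
    have e0 : Module.finrank ℝ V₁ = Module.finrank ℝ V₂ := by
      have := hrank 0
      rwa [pow_zero, pow_zero, Module.End.one_eq_id, Module.End.one_eq_id, LinearMap.range_id,
        LinearMap.range_id, finrank_top, finrank_top] at this
    have e1 : Module.finrank ℝ (LinearMap.range N₁) = Module.finrank ℝ (LinearMap.range N₂) := by
      have := hrank 1
      rwa [pow_one, pow_one] at this
    have e2 := hrank 2
    obtain ⟨g, hg⟩ := exists_preserving_of_finrank_range_le
      (Q₁.compl₁₂ (LinearMap.ker N₁).subtype (LinearMap.ker N₁).subtype)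
      (Q₂.compl₁₂ (LinearMap.ker N₂).subtype (LinearMap.ker N₂).subtype)
      (fun x y => by simpa using hs₁ x y) (fun x y => by simpa using hs₂ x y) (by omega)
    obtain ⟨f, hf⟩ := ((LinearMap.ker N₂).subtype ∘ₗ g).exists_extend
    have hf' (u) (hu : N₁ u = 0) : f u = g ⟨u, hu⟩ := LinearMap.congr_fun hf ⟨u, hu⟩
    refine ⟨f, fun u hu => ?_, fun u v hu hv => ?_⟩
    · rw [hf' u hu]
      exact (g ⟨u, hu⟩).2
    · rw [hf' u hu, hf' v hv]
      exact hg ⟨u, hu⟩ ⟨v, hv⟩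

/-- An isometric intertwiner between the ranges extends to an isometric intertwiner. -/
lemma exists_isometry_extension [FiniteDimensional ℝ V₁]
    {Q₁ : V₁ →ₗ[ℝ] V₁ →ₗ[ℝ] ℝ} {Q₂ : V₂ →ₗ[ℝ] V₂ →ₗ[ℝ] ℝ} {N₁ : Module.End ℝ V₁}
    {N₂ : Module.End ℝ V₂} {ε : ℝ} (hε : ε * ε = 1)
    (hQ₁ : ∀ u, (∀ v, Q₁ u v = 0) → u = 0)
    (hs₁ : ∀ u v, Q₁ u v = ε * Q₁ v u) (hs₂ : ∀ u v, Q₂ u v = ε * Q₂ v u)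
    (hN₁ : ∀ u v, Q₁ (N₁ u) v + Q₁ u (N₁ v) = 0) (hN₂ : ∀ u v, Q₂ (N₂ u) v + Q₂ u (N₂ v) = 0)
    (h' : LinearMap.range N₁ →ₗ[ℝ] LinearMap.range N₂)
    (hh' : ∀ x y : LinearMap.range N₁, N₁ x = y → N₂ (h' x) = h' y)
    (hiso : ∀ (u₁ u₂) (x y : LinearMap.range N₁), N₁ u₁ = x → N₂ u₂ = h' x →
      Q₂ u₂ (h' y) = Q₁ u₁ y)
    (f : V₁ →ₗ[ℝ] V₂) (hf : ∀ u, N₁ u = 0 → N₂ (f u) = 0)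
    (hfQ : ∀ u v, N₁ u = 0 → N₁ v = 0 → Q₂ (f u) (f v) = Q₁ u v) :
    ∃ h : V₁ →ₗ[ℝ] V₂, (∀ u, N₂ (h u) = h (N₁ u)) ∧ ∀ u v, Q₂ (h u) (h v) = Q₁ u v := by
  obtain ⟨h, hN, hr, hk⟩ := exists_intertwining_extension h' hh' f hf
  obtain ⟨S, hNS, hSN, hS⟩ := exists_correction (P := Q₂.compl₁₂ h h) hε hQ₁ hs₁
    (fun u v => hs₂ _ _) hN₁
    (fun u v => by
      have h1 := hr ⟨N₁ v, LinearMap.mem_range_self _ _⟩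
      rw [LinearMap.compl₁₂_apply, h1]
      exact hiso u (h u) ⟨N₁ u, LinearMap.mem_range_self _ _⟩ _ rfl (hN u _ rfl))
    (fun u v hu hv => by
      obtain ⟨y, hy, hyu⟩ := hk u hu
      obtain ⟨z, hz, hzv⟩ := hk v hv
      have hy' : N₂ (h' y) = 0 := by simpa using hh' y 0 (by simpa using hy)
      have hz' : N₂ (h' z) = 0 := by simpa using hh' z 0 (by simpa using hz)
      have huy : N₁ (u - y) = 0 := by rw [map_sub, hu, hy, sub_zero]
      have hvz : N₁ (v - z) = 0 := by rw [map_sub, hv, hz, sub_zero]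
      rw [LinearMap.compl₁₂_apply, hyu, hzv]
      simp only [map_add, LinearMap.add_apply]
      rw [hfQ _ _ huy hvz, apply_ker_range_eq_zero hN₂ hy' (h' z).2,
        apply_ker_range_eq_zero hN₂ (hf _ huy) (h' z).2,
        apply_range_ker_eq_zero hN₂ (h' y).2 (hf _ hvz)]
      simp only [map_sub, LinearMap.sub_apply]
      rw [apply_ker_range_eq_zero hN₁ hu z.2, apply_range_ker_eq_zero hN₁ y.2 hv,
        apply_range_ker_eq_zero hN₁ y.2 hz]
      ring)
  refine ⟨h ∘ₗ S, fun u => ?_, hS⟩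
  rw [LinearMap.comp_apply, LinearMap.comp_apply, hSN,
    hN (S u) ⟨N₁ u, LinearMap.mem_range_self _ _⟩ (hNS u), ← hr]

end SkewAdjoint

lemma coe_restrict_range_pow_apply {V : Type*} [AddCommGroup V] [Module ℝ V] (N : Module.End ℝ V)
    (hN : ∀ x ∈ LinearMap.range N, N x ∈ LinearMap.range N) (ℓ : ℕ) (x : LinearMap.range N) :
    (((N.restrict hN) ^ ℓ) x : V) = (N ^ ℓ) x := by
  rw [Module.End.pow_restrict ℓ hN, LinearMap.restrict_apply]

lemma finrank_range_restrict_range_pow {V : Type*} [AddCommGroup V] [Module ℝ V]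
    (N : Module.End ℝ V) (hN : ∀ x ∈ LinearMap.range N, N x ∈ LinearMap.range N) (ℓ : ℕ) :
    Module.finrank ℝ (LinearMap.range ((N.restrict hN) ^ ℓ)) =
      Module.finrank ℝ (LinearMap.range (N ^ (ℓ + 1))) := by
  rw [← Submodule.finrank_map_subtype_eq]
  refine congrArg (fun p : Submodule ℝ V => Module.finrank ℝ p) ?_
  ext u
  constructor
  · rintro ⟨_, ⟨⟨_, v, rfl⟩, rfl⟩, rfl⟩
    refine ⟨v, ?_⟩
    rw [pow_succ, Module.End.mul_apply, Submodule.subtype_apply, coe_restrict_range_pow_apply]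
  · rintro ⟨v, rfl⟩
    refine ⟨_, ⟨⟨N v, LinearMap.mem_range_self _ _⟩, rfl⟩, ?_⟩
    rw [pow_succ, Module.End.mul_apply, Submodule.subtype_apply, coe_restrict_range_pow_apply]

/-- A nilpotent skew-adjoint `N₁` maps isometrically to `N₂` as soon as the ranks of their powers
agree and the forms `u ↦ Q₁ u (N₁ ^ ℓ u)` on the kernels of `N₁ ^ (ℓ + 1)` map to those of `N₂`. -/
theorem exists_isometric_intertwiner (k : ℕ) :
    ∀ {V₁ V₂ : Type} [AddCommGroup V₁] [Module ℝ V₁] [FiniteDimensional ℝ V₁]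
      [AddCommGroup V₂] [Module ℝ V₂] [FiniteDimensional ℝ V₂]
      (Q₁ : V₁ →ₗ[ℝ] V₁ →ₗ[ℝ] ℝ) (Q₂ : V₂ →ₗ[ℝ] V₂ →ₗ[ℝ] ℝ)
      (N₁ : Module.End ℝ V₁) (N₂ : Module.End ℝ V₂) (ε : ℝ) (_ : ε * ε = 1)
      (_ : ∀ u, (∀ v, Q₁ u v = 0) → u = 0) (_ : ∀ u, (∀ v, Q₂ u v = 0) → u = 0)
      (_ : ∀ u v, Q₁ u v = ε * Q₁ v u) (_ : ∀ u v, Q₂ u v = ε * Q₂ v u)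
      (_ : ∀ u v, Q₁ (N₁ u) v + Q₁ u (N₁ v) = 0) (_ : ∀ u v, Q₂ (N₂ u) v + Q₂ u (N₂ v) = 0)
      (_ : N₁ ^ k = 0)
      (_ : ∀ ℓ : ℕ, Module.finrank ℝ (LinearMap.range (N₁ ^ ℓ)) =
        Module.finrank ℝ (LinearMap.range (N₂ ^ ℓ)))
      (_ : ∀ ℓ : ℕ, ∃ φ : V₁ →ₗ[ℝ] V₂, ∀ u, (N₁ ^ (ℓ + 1)) u = 0 →
        (N₂ ^ (ℓ + 1)) (φ u) = 0 ∧ Q₂ (φ u) ((N₂ ^ ℓ) (φ u)) = Q₁ u ((N₁ ^ ℓ) u)),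
      ∃ h : V₁ →ₗ[ℝ] V₂, (∀ u, N₂ (h u) = h (N₁ u)) ∧ ∀ u v, Q₂ (h u) (h v) = Q₁ u v := by
  induction k with
  | zero =>
    intro V₁ V₂ _ _ _ _ _ _ Q₁ Q₂ N₁ N₂ ε _ _ _ _ _ _ _ hnil _ _
    have hzero (u : V₁) : u = 0 := by
      rw [pow_zero] at hnil
      exact LinearMap.congr_fun hnil u
    exact ⟨0, fun u => by simp, fun u v => by simp [hzero u]⟩
  | succ k ih =>
    intro V₁ V₂ _ _ _ _ _ _ Q₁ Q₂ N₁ N₂ ε hε hQ₁ hQ₂ hs₁ hs₂ hN₁ hN₂ hnil hrank hφ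
    obtain ⟨φ₀, hφ₀⟩ := hφ 0
    obtain ⟨f, hf, hfQ⟩ := exists_ker_preserving hε hQ₁ hQ₂ hs₁ hs₂ hN₁ hN₂ hrank φ₀
      (fun u hu => by simpa using hφ₀ u (by simpa using hu))
    obtain ⟨R₁, hR₁⟩ := exists_rangeForm hN₁
    obtain ⟨R₂, hR₂⟩ := exists_rangeForm hN₂
    have nondeg {V : Type} [AddCommGroup V] [Module ℝ V] {Q : V →ₗ[ℝ] V →ₗ[ℝ] ℝ}
        {N : Module.End ℝ V} {R : LinearMap.range N →ₗ[ℝ] LinearMap.range N →ₗ[ℝ] ℝ}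
        (hQ : ∀ u, (∀ v, Q u v = 0) → u = 0) (hN : ∀ u v, Q (N u) v + Q u (N v) = 0)
        (hR : ∀ (u : V) (x y : LinearMap.range N), N u = x → R x y = Q u y)
        (x) (hx : ∀ y, R x y = 0) : x = 0 := by
      obtain ⟨_, u, rfl⟩ := x
      refine Subtype.ext (hQ _ fun v => ?_)
      have h1 := hx ⟨N v, LinearMap.mem_range_self _ _⟩
      rw [hR u _ _ rfl] at h1
      simpa [h1] using hN u v
    have symm {V : Type} [AddCommGroup V] [Module ℝ V] {Q : V →ₗ[ℝ] V →ₗ[ℝ] ℝ}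
        {N : Module.End ℝ V} {R : LinearMap.range N →ₗ[ℝ] LinearMap.range N →ₗ[ℝ] ℝ}
        (hs : ∀ u v, Q u v = ε * Q v u) (hN : ∀ u v, Q (N u) v + Q u (N v) = 0)
        (hR : ∀ (u : V) (x y : LinearMap.range N), N u = x → R x y = Q u y)
        (x y) : R x y = -ε * R y x := by
      obtain ⟨_, u, rfl⟩ := x
      obtain ⟨_, v, rfl⟩ := y
      rw [hR u _ _ rfl, hR v _ _ rfl]
      linarith [hN u v, hs (N u) v]
    have skew {V : Type} [AddCommGroup V] [Module ℝ V] {Q : V →ₗ[ℝ] V →ₗ[ℝ] ℝ}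
        {N : Module.End ℝ V} {R : LinearMap.range N →ₗ[ℝ] LinearMap.range N →ₗ[ℝ] ℝ}
        (hN : ∀ u v, Q (N u) v + Q u (N v) = 0)
        (hR : ∀ (u : V) (x y : LinearMap.range N), N u = x → R x y = Q u y)
        (hr : ∀ x ∈ LinearMap.range N, N x ∈ LinearMap.range N)
        (x y) : R (N.restrict hr x) y + R x (N.restrict hr y) = 0 := by
      obtain ⟨_, u, rfl⟩ := x
      rw [hR (N u) _ _ rfl, hR u _ _ rfl]
      exact hN u y
    have hr₁ : ∀ x ∈ LinearMap.range N₁, N₁ x ∈ LinearMap.range N₁ :=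
      fun x _ => LinearMap.mem_range_self _ x
    have hr₂ : ∀ x ∈ LinearMap.range N₂, N₂ x ∈ LinearMap.range N₂ :=
      fun x _ => LinearMap.mem_range_self _ x
    obtain ⟨s, hs⟩ := N₁.rangeRestrict.exists_rightInverse_of_surjective N₁.range_rangeRestrict
    have hs' (x : LinearMap.range N₁) : N₁ (s x) = x :=
      congrArg Subtype.val (LinearMap.congr_fun hs x)
    obtain ⟨h', hh', hiso⟩ := ih R₁ R₂ (N₁.restrict hr₁) (N₂.restrict hr₂) (-ε) (by linarith)
      (nondeg hQ₁ hN₁ hR₁) (nondeg hQ₂ hN₂ hR₂) (symm hs₁ hN₁ hR₁) (symm hs₂ hN₂ hR₂)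
      (skew hN₁ hR₁ hr₁) (skew hN₂ hR₂ hr₂)
      (by
        ext ⟨_, u, rfl⟩
        rw [coe_restrict_range_pow_apply]
        exact LinearMap.congr_fun (pow_succ N₁ k ▸ hnil) u)
      (fun ℓ => by
        rw [finrank_range_restrict_range_pow, finrank_range_restrict_range_pow, hrank])
      (fun ℓ => by
        obtain ⟨φ, hφ⟩ := hφ (ℓ + 1)
        refine ⟨N₂.rangeRestrict ∘ₗ φ ∘ₗ s, fun x hx => ?_⟩
        have hsx : (N₁ ^ (ℓ + 1 + 1)) (s x) = 0 := by
          rw [pow_succ, Module.End.mul_apply, hs', ← coe_restrict_range_pow_apply N₁ hr₁, hx]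
          rfl
        obtain ⟨h1, h2⟩ := hφ _ hsx
        constructor
        · ext
          rw [coe_restrict_range_pow_apply]
          rwa [pow_succ, Module.End.mul_apply] at h1
        · rw [hR₂ (φ (s x)) _ _ rfl, hR₁ (s x) _ _ (hs' x), coe_restrict_range_pow_apply,
            coe_restrict_range_pow_apply]
          rwa [pow_succ, Module.End.mul_apply, pow_succ, Module.End.mul_apply, hs'] at h2)
    refine exists_isometry_extension hε hQ₁ hs₁ hs₂ hN₁ hN₂ h' (fun x y hxy => ?_)
      (fun u₁ u₂ x y hx hu => ?_) f hf hfQ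
    · have h1 : N₁.restrict hr₁ x = y := Subtype.ext hxy
      rw [← h1, ← hh']
      rfl
    · rw [← hR₂ u₂ _ _ hu, hiso, hR₁ u₁ _ _ hx]

/-- For a nondegenerate skew-symmetric bilinear form `Q` on a finite-dimensional
real vector space `V`, two nilpotent infinitesimal isometries `N₁, N₂` of `Q` are conjugate by
an element of `Aut(V, Q)` if and only if for every `ℓ ≥ 0`: `rank (N₁^ℓ) = rank (N₂^ℓ)` and
there is a linear isomorphism `φ : ker (N₁^(ℓ+1)) → ker (N₂^(ℓ+1))` with
`Q(φ u, N₂^ℓ (φ u)) = Q(u, N₁^ℓ u)` for all `u`.  (Classification of real symplectic nilpotent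
orbits by signed Young diagrams.) -/
theorem stmt5 {V : Type} [AddCommGroup V] [Module ℝ V] [FiniteDimensional ℝ V]
    (Q : V →ₗ[ℝ] V →ₗ[ℝ] ℝ)
    (hQnd : ∀ u : V, (∀ v : V, Q u v = 0) → u = 0)
    (hQskew : ∀ u v : V, Q u v = - Q v u)
    (N₁ N₂ : Module.End ℝ V)
    (hN₁nil : IsNilpotent N₁) (hN₂nil : IsNilpotent N₂)
    (hN₁iso : ∀ u v : V, Q (N₁ u) v + Q u (N₁ v) = 0)
    (hN₂iso : ∀ u v : V, Q (N₂ u) v + Q u (N₂ v) = 0) :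
    (∃ g : V ≃ₗ[ℝ] V, (∀ u v : V, Q (g u) (g v) = Q u v) ∧
        (g : V →ₗ[ℝ] V) ∘ₗ N₁ ∘ₗ (g.symm : V →ₗ[ℝ] V) = N₂) ↔
      (∀ ℓ : ℕ,
        Module.finrank ℝ (LinearMap.range (N₁ ^ ℓ)) =
          Module.finrank ℝ (LinearMap.range (N₂ ^ ℓ)) ∧
        ∃ φ : LinearMap.ker (N₁ ^ (ℓ + 1)) ≃ₗ[ℝ] LinearMap.ker (N₂ ^ (ℓ + 1)),
          ∀ u : LinearMap.ker (N₁ ^ (ℓ + 1)),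
            Q (φ u : V) ((N₂ ^ ℓ) (φ u : V)) = Q (u : V) ((N₁ ^ ℓ) (u : V))) := by
  constructor
  · rintro ⟨g, hgQ, hg⟩ ℓ
    have hgN (u : V) : N₂ (g u) = g (N₁ u) := by
      rw [← hg]
      simp
    have hpow (ℓ : ℕ) (u : V) : (N₂ ^ ℓ) (g u) = g ((N₁ ^ ℓ) u) := by
      induction ℓ generalizing u with
      | zero => simp
      | succ ℓ ih => rw [pow_succ, Module.End.mul_apply, hgN, ih, pow_succ, Module.End.mul_apply]
    have hrange : (LinearMap.range (N₁ ^ ℓ)).map (g : V →ₗ[ℝ] V) = LinearMap.range (N₂ ^ ℓ) := by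
      ext u
      constructor
      · rintro ⟨_, ⟨v, rfl⟩, rfl⟩
        exact ⟨g v, hpow ℓ v⟩
      · rintro ⟨v, rfl⟩
        refine ⟨_, ⟨g.symm v, rfl⟩, ?_⟩
        simp [← hpow]
    have hker : (LinearMap.ker (N₁ ^ (ℓ + 1))).map (g : V →ₗ[ℝ] V) =
        LinearMap.ker (N₂ ^ (ℓ + 1)) := by
      ext u
      constructor
      · rintro ⟨v, hv, rfl⟩
        have hv' : (N₁ ^ (ℓ + 1)) v = 0 := hv
        rw [LinearMap.mem_ker, LinearEquiv.coe_coe, hpow, hv', map_zero]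
      · intro hu
        refine ⟨g.symm u, g.injective ?_, g.apply_symm_apply u⟩
        rw [← hpow, g.apply_symm_apply, map_zero]
        exact hu
    refine ⟨?_, g.ofSubmodules _ _ hker, fun u => ?_⟩
    · rw [← hrange, LinearEquiv.finrank_map_eq]
    · rw [LinearEquiv.ofSubmodules_apply, hpow, hgQ]
  · intro H
    obtain ⟨k, hk⟩ := hN₁nil
    obtain ⟨h, hN, hQ⟩ := exists_isometric_intertwiner k Q Q N₁ N₂ (-1) (by norm_num) hQnd hQnd
      (by simpa using hQskew) (by simpa using hQskew) hN₁iso hN₂iso hk (fun ℓ => (H ℓ).1)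
      (fun ℓ => by
        obtain ⟨-, φ, hφ⟩ := H ℓ
        obtain ⟨ψ, hψ⟩ := ((LinearMap.ker (N₂ ^ (ℓ + 1))).subtype ∘ₗ φ.toLinearMap).exists_extend
        refine ⟨ψ, fun u hu => ?_⟩
        have hu' : ψ u = φ ⟨u, hu⟩ := LinearMap.congr_fun hψ ⟨u, hu⟩
        rw [hu']
        exact ⟨(φ ⟨u, hu⟩).2, hφ ⟨u, hu⟩⟩)
    have hinj : Function.Injective h := by
      rw [injective_iff_map_eq_zero]
      exact fun u hu => hQnd u fun v => by rw [← hQ, hu, map_zero, LinearMap.zero_apply]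
    let g := LinearEquiv.ofInjectiveEndo h hinj
    refine ⟨g, hQ, ?_⟩
    ext u
    obtain ⟨v, rfl⟩ := g.surjective u
    rw [LinearMap.comp_apply, LinearMap.comp_apply, LinearEquiv.coe_coe, LinearEquiv.coe_coe,
      g.symm_apply_apply]
    exact (hN v).symm
end

section
/- Let N₁ and N₂ be nilpotent infinitesimal isometries of Q. Then there exists g ∈ Aut(V, Q) with g ∘ N₁ ∘ g⁻¹ = N₂ if and only if for every integer ℓ ≥ 0 the following hold: rank(N₁^ℓ) = rank(N₂^ℓ), and there exists a linear isomorphism φ : ker(N₁^{ℓ+1}) → ker(N₂^{ℓ+1}) with Q(φu, N₂^ℓ(φu)) = Q(u, N₁^ℓ u) for all u ∈ ker(N₁^{ℓ+1}). (This expresses the classification of real orthogonal nilpotent orbits by signed Young diagrams: the signatures of the induced quadratic forms u ↦ Q(u, N^ℓ u) on ker(N^{ℓ+1}) together with the ranks of the powers of N form a complete set of invariants.) -/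
section NilpotentIsometries

open Module

universe u v w

variable {V : Type u} {P : Type v} {M : Type w} [AddCommGroup V] [Module ℝ V] [AddCommGroup P] [Module ℝ P]
  [AddCommGroup M] [Module ℝ M]

/-- `Q` is a nondegenerate symmetric form and `N` is an infinitesimal isometry of `Q` with
`N ^ k = 0`. -/
structure IsNilpotentIsometry (Q : V →ₗ[ℝ] V →ₗ[ℝ] ℝ) (N : End ℝ V) (k : ℕ) : Prop where
  nondegenerate : ∀ u, (∀ v, Q u v = 0) → u = 0
  symm : ∀ u v, Q u v = Q v u
  skew : ∀ u v, Q (N u) v + Q u (N v) = 0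
  pow_eq_zero : N ^ k = 0

namespace IsNilpotentIsometry

variable {Q : V →ₗ[ℝ] V →ₗ[ℝ] ℝ} {N : End ℝ V} {k : ℕ}

theorem apply_pow_left (h : IsNilpotentIsometry Q N k) (j : ℕ) (u v : V) :
    Q ((N ^ j) u) v = (-1) ^ j * Q u ((N ^ j) v) := by
  induction j generalizing u v with
  | zero => simp
  | succ j ih =>
    rw [pow_succ, Module.End.mul_apply, ih, ← pow_succ, pow_succ' N, Module.End.mul_apply]
    have := h.skew u ((N ^ j) v)
    rw [pow_succ]
    linear_combination (-1) ^ j * this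

theorem apply_pow_swap (h : IsNilpotentIsometry Q N k) (j : ℕ) (u v : V) :
    Q u ((N ^ j) v) = (-1) ^ j * Q v ((N ^ j) u) := by
  rw [h.symm, h.apply_pow_left]

theorem pow_apply_eq_zero (h : IsNilpotentIsometry Q N k) {j : ℕ} (hj : k ≤ j) (u : V) :
    (N ^ j) u = 0 := by
  rw [pow_eq_zero_of_le hj h.pow_eq_zero, LinearMap.zero_apply]

end IsNilpotentIsometry

theorem exists_forall_apply_eq [FiniteDimensional ℝ P] (b : P →ₗ[ℝ] P →ₗ[ℝ] ℝ)
    (hb : ∀ u, (∀ v, b u v = 0) → u = 0) (c : V →ₗ[ℝ] P →ₗ[ℝ] ℝ) :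
    ∃ S : V →ₗ[ℝ] P, ∀ x p, b (S x) p = c x p := by
  have hinj : Function.Injective b := by
    rw [injective_iff_map_eq_zero]
    exact fun u hu => hb u fun v => by rw [hu, LinearMap.zero_apply]
  let e : P ≃ₗ[ℝ] Dual ℝ P :=
    LinearMap.linearEquivOfInjective b hinj Subspace.dual_finrank_eq.symm
  refine ⟨e.symm.toLinearMap ∘ₗ c, fun x p => ?_⟩
  have : b (e.symm (c x)) = c x := e.apply_symm_apply (c x)
  exact LinearMap.congr_fun this p

/-- Orthogonal projection onto the source of a map along which the form pulls back to a
nondegenerate form. -/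
theorem exists_orthogonal_projection [FiniteDimensional ℝ M] (b : V →ₗ[ℝ] V →ₗ[ℝ] ℝ)
    (F : M →ₗ[ℝ] V) (hF : ∀ m, (∀ m', b (F m) (F m') = 0) → m = 0) :
    ∃ π : V →ₗ[ℝ] M, (∀ m, π (F m) = m) ∧ ∀ v m, b (v - F (π v)) (F m) = 0 := by
  obtain ⟨π, hπ⟩ := exists_forall_apply_eq (b.compl₁₂ F F) hF (b.compl₁₂ LinearMap.id F)
  simp only [LinearMap.compl₁₂_apply, LinearMap.id_apply] at hπ
  refine ⟨π, fun m => ?_, fun v m => by simp [hπ]⟩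
  rw [← sub_eq_zero]
  exact hF _ fun m' => by simp [hπ]

/-- A nondegenerate alternating form embeds isometrically in any nondegenerate alternating form
on a space of the same dimension. -/
theorem exists_isometry_of_alternating (n : ℕ) : ∀ {P₁ P₂ : Type u} [AddCommGroup P₁]
    [Module ℝ P₁] [AddCommGroup P₂] [Module ℝ P₂] [FiniteDimensional ℝ P₁]
    [FiniteDimensional ℝ P₂] (b₁ : P₁ →ₗ[ℝ] P₁ →ₗ[ℝ] ℝ) (b₂ : P₂ →ₗ[ℝ] P₂ →ₗ[ℝ] ℝ),
    (∀ u, (∀ v, b₁ u v = 0) → u = 0) → (∀ u, (∀ v, b₂ u v = 0) → u = 0) →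
    (∀ u v, b₁ u v = -b₁ v u) → (∀ u v, b₂ u v = -b₂ v u) →
    finrank ℝ P₁ = n → finrank ℝ P₂ = n →
    ∃ f : P₁ →ₗ[ℝ] P₂, ∀ u v, b₂ (f u) (f v) = b₁ u v := by
  -- the splitting of a hyperbolic plane
  have plane : ∀ {P : Type u} [AddCommGroup P] [Module ℝ P] [FiniteDimensional ℝ P]
      (b : P →ₗ[ℝ] P →ₗ[ℝ] ℝ), (∀ u, (∀ v, b u v = 0) → u = 0) → (∀ u v, b u v = -b v u) →
      finrank ℝ P ≠ 0 → ∃ (F : (ℝ × ℝ) →ₗ[ℝ] P) (π : P →ₗ[ℝ] ℝ × ℝ),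
        (∀ m, π (F m) = m) ∧ (∀ v m, b (v - F (π v)) (F m) = 0) ∧
        (∀ m m', b (F m) (F m') = m.1 * m'.2 - m.2 * m'.1) := by
    intro P _ _ _ b hb halt hP
    obtain ⟨u, hu⟩ : ∃ u : P, u ≠ 0 := by
      by_contra! h
      have : Subsingleton P := ⟨fun x y => by rw [h x, h y]⟩
      exact hP finrank_zero_of_subsingleton
    obtain ⟨v, hv⟩ : ∃ v, b u v ≠ 0 := by
      by_contra! h
      exact hu (hb u h)
    let w := (b u v)⁻¹ • v
    have huw : b u w = 1 := by simp [w, hv]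
    have hself : ∀ x, b x x = 0 := fun x => by linarith [halt x x]
    let F : (ℝ × ℝ) →ₗ[ℝ] P :=
      (LinearMap.toSpanSingleton ℝ P u).coprod (LinearMap.toSpanSingleton ℝ P w)
    have hF : ∀ m m', b (F m) (F m') = m.1 * m'.2 - m.2 * m'.1 := by
      intro m m'
      have hwu : b w u = -1 := by rw [halt, huw]
      simp [F, LinearMap.toSpanSingleton_apply, hself, huw, hwu]
      ring
    have hnd : ∀ m, (∀ m', b (F m) (F m') = 0) → m = 0 := by
      intro m hm
      have h1 := hm (0, 1)
      have h2 := hm (1, 0)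
      rw [hF] at h1 h2
      ext <;> simp at h1 h2 ⊢ <;> assumption
    obtain ⟨π, h1, h2⟩ := exists_orthogonal_projection b F hnd
    exact ⟨F, π, h1, h2, hF⟩
  induction n using Nat.strong_induction_on with
  | _ n ih =>
    intro P₁ P₂ _ _ _ _ _ _ b₁ b₂ hb₁ hb₂ ha₁ ha₂ hn₁ hn₂
    rcases Nat.eq_zero_or_pos n with rfl | hn
    · have := finrank_zero_iff.mp hn₁
      exact ⟨0, fun u v => by simp [Subsingleton.elim u 0]⟩
    obtain ⟨F₁, π₁, l₁, o₁, f₁⟩ := plane b₁ hb₁ ha₁ (by omega)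
    obtain ⟨F₂, π₂, l₂, o₂, f₂⟩ := plane b₂ hb₂ ha₂ (by omega)
    have nd : ∀ {P : Type u} [AddCommGroup P] [Module ℝ P]
        (b : P →ₗ[ℝ] P →ₗ[ℝ] ℝ) (F : (ℝ × ℝ) →ₗ[ℝ] P) (π : P →ₗ[ℝ] ℝ × ℝ),
        (∀ u, (∀ v, b u v = 0) → u = 0) → (∀ m, π (F m) = m) →
        (∀ v m, b (v - F (π v)) (F m) = 0) → ∀ u : LinearMap.ker π,
        (∀ v : LinearMap.ker π, b u v = 0) → u = 0 := by
      intro P _ _ b F π hb hl ho u hu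
      refine Subtype.ext (hb _ fun v => ?_)
      have h1 := hu ⟨v - F (π v), by simp [hl]⟩
      have h2 := ho u (π v)
      rw [u.2] at h2
      simp only [map_sub, map_zero, sub_zero] at h1 h2
      linarith
    have dim : ∀ {P : Type u} [AddCommGroup P] [Module ℝ P] [FiniteDimensional ℝ P]
        (F : (ℝ × ℝ) →ₗ[ℝ] P) (π : P →ₗ[ℝ] ℝ × ℝ), (∀ m, π (F m) = m) →
        finrank ℝ P = n → finrank ℝ (LinearMap.ker π) = n - 2 := by
      intro P _ _ _ F π hl hP
      have := π.finrank_range_add_finrank_ker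
      rw [LinearMap.range_eq_top.mpr fun m => ⟨F m, hl m⟩, finrank_top, finrank_prod,
        finrank_self] at this
      omega
    obtain ⟨f, hf⟩ := ih (n - 2) (by omega)
      (b₁.compl₁₂ (LinearMap.ker π₁).subtype (LinearMap.ker π₁).subtype)
      (b₂.compl₁₂ (LinearMap.ker π₂).subtype (LinearMap.ker π₂).subtype)
      (nd b₁ F₁ π₁ hb₁ l₁ o₁) (nd b₂ F₂ π₂ hb₂ l₂ o₂)
      (fun u v => ha₁ _ _) (fun u v => ha₂ _ _) (dim F₁ π₁ l₁ hn₁) (dim F₂ π₂ l₂ hn₂)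
    let r : P₁ →ₗ[ℝ] LinearMap.ker π₁ :=
      (LinearMap.id - F₁ ∘ₗ π₁).codRestrict _ fun v => by simp [l₁]
    refine ⟨F₂ ∘ₗ π₁ + (LinearMap.ker π₂).subtype ∘ₗ f ∘ₗ r, fun u v => ?_⟩
    have hr : ∀ v, (r v : P₁) = v - F₁ (π₁ v) := fun v => rfl
    have key₂ : ∀ (x : LinearMap.ker π₂) m, b₂ x (F₂ m) = 0 := fun x m => by
      simpa [LinearMap.mem_ker.mp x.2] using o₂ x m
    have key₁ : ∀ x m, b₁ (r x) (F₁ m) = 0 := o₁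
    have hfr := hf (r u) (r v)
    simp only [LinearMap.compl₁₂_apply, Submodule.subtype_apply] at hfr
    have e₁ : b₁ u v = b₁ (F₁ (π₁ u) + r u) (F₁ (π₁ v) + r v) := by simp [hr]
    rw [e₁]
    simp only [LinearMap.add_apply, LinearMap.comp_apply, Submodule.subtype_apply, map_add,
      hfr, key₁, key₂, f₁, f₂, ha₁ (F₁ _) (r _ : P₁), ha₂ (F₂ _) (f _ : P₂)]

/-- The nilpotent shift `(p₀, …, pₖ) ↦ (0, p₀, …, pₖ₋₁)`. -/
def truncatedShift (P : Type v) [AddCommGroup P] [Module ℝ P] (k : ℕ) :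
    End ℝ (Fin (k + 1) → P) :=
  LinearMap.pi fun j => Fin.cases 0 (fun i => LinearMap.proj i.castSucc) j

theorem truncatedShift_zero (k : ℕ) (p : Fin (k + 1) → P) : truncatedShift P k p 0 = 0 := rfl

theorem truncatedShift_succ (k : ℕ) (p : Fin (k + 1) → P) (i : Fin k) :
    truncatedShift P k p i.succ = p i.castSucc := rfl

theorem truncatedShift_pow_apply (k l : ℕ) (p : Fin (k + 1) → P) (j : Fin (k + 1)) :
    ((truncatedShift P k) ^ l) p j = if l ≤ (j : ℕ) then p ⟨j - l, by omega⟩ else 0 := by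
  induction l generalizing j with
  | zero => simp
  | succ l ih =>
    rw [pow_succ', Module.End.mul_apply]
    cases j using Fin.cases with
    | zero => simp [truncatedShift_zero]
    | succ i => simp [truncatedShift_succ, ih]

/-- The map `(p₀, …, pₖ) ↦ ∑ Nʲ (i pⱼ)`. -/
def jordanMap (N : End ℝ V) (k : ℕ) (i : P →ₗ[ℝ] V) : (Fin (k + 1) → P) →ₗ[ℝ] V :=
  ∑ j : Fin (k + 1), (N ^ (j : ℕ)) ∘ₗ i ∘ₗ LinearMap.proj j

theorem jordanMap_apply (N : End ℝ V) (k : ℕ) (i : P →ₗ[ℝ] V) (p : Fin (k + 1) → P) :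
    jordanMap N k i p = ∑ j : Fin (k + 1), (N ^ (j : ℕ)) (i (p j)) := by
  simp [jordanMap]

theorem jordanMap_truncatedShift {N : End ℝ V} {k : ℕ} (hN : N ^ (k + 1) = 0) (i : P →ₗ[ℝ] V)
    (p : Fin (k + 1) → P) : jordanMap N k i (truncatedShift P k p) = N (jordanMap N k i p) := by
  rw [jordanMap_apply, jordanMap_apply, Fin.sum_univ_succ, Fin.sum_univ_castSucc, map_add,
    map_sum, ← Module.End.mul_apply N, Fin.val_last, ← pow_succ', hN]
  simp [truncatedShift_zero, truncatedShift_succ, pow_succ']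

theorem jordanMap_single (N : End ℝ V) (k : ℕ) (i : P →ₗ[ℝ] V) (j : Fin (k + 1)) (u : P) :
    jordanMap N k i (Pi.single j u) = (N ^ (j : ℕ)) (i u) := by
  rw [jordanMap_apply, Finset.sum_eq_single j (fun l _ hl => by simp [hl]) (by simp),
    Pi.single_eq_same]

section Normalized

variable {Q : V →ₗ[ℝ] V →ₗ[ℝ] ℝ} {N : End ℝ V} {k : ℕ} {i : P →ₗ[ℝ] V}

theorem IsNilpotentIsometry.apply_jordanMap (h : IsNilpotentIsometry Q N (k + 1))
    (hi : ∀ j < k, ∀ u v, Q (i u) ((N ^ j) (i v)) = 0) (p q : Fin (k + 1) → P) :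
    Q (jordanMap N k i p) (jordanMap N k i q) =
      ∑ j : Fin (k + 1), (-1) ^ (j : ℕ) * Q (i (p j)) ((N ^ k) (i (q j.rev))) := by
  simp only [jordanMap_apply, map_sum, LinearMap.sum_apply]
  rw [Finset.sum_comm]
  refine Finset.sum_congr rfl fun j _ => ?_
  rw [Finset.sum_eq_single j.rev]
  · rw [h.apply_pow_left, ← Module.End.mul_apply, ← pow_add]
    congr 5
    rw [Fin.val_rev]
    omega
  · intro l _ hl
    rw [h.apply_pow_left, ← Module.End.mul_apply, ← pow_add]
    have : (j : ℕ) + l ≠ k := fun e => hl (Fin.ext (by rw [Fin.val_rev]; omega))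
    rcases lt_or_gt_of_ne this with h' | h'
    · rw [hi _ h', mul_zero]
    · rw [h.pow_apply_eq_zero h', map_zero, mul_zero]
  · simp

theorem IsNilpotentIsometry.eq_zero_of_apply_jordanMap (h : IsNilpotentIsometry Q N (k + 1))
    (hi : ∀ j < k, ∀ u v, Q (i u) ((N ^ j) (i v)) = 0)
    (hnd : ∀ u, (∀ v, Q (i u) ((N ^ k) (i v)) = 0) → u = 0) (p : Fin (k + 1) → P)
    (hp : ∀ q, Q (jordanMap N k i p) (jordanMap N k i q) = 0) : p = 0 := by
  funext j
  refine hnd _ fun v => ?_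
  have := hp (Pi.single j.rev v)
  rw [h.apply_jordanMap hi, Finset.sum_eq_single j] at this
  · simpa using this
  · intro l _ hl
    rw [Pi.single_eq_of_ne (Fin.rev_injective.ne hl)]
    simp
  · simp

theorem IsNilpotentIsometry.apply_jordanMap_pow_eq_zero (h : IsNilpotentIsometry Q N (k + 1))
    (hi : ∀ j < k, ∀ u v, Q (i u) ((N ^ j) (i v)) = 0) {l : ℕ} (hl : l < k)
    (p : Fin (k + 1) → P) (hp : ((truncatedShift P k) ^ (l + 1)) p = 0) :
    Q (jordanMap N k i p) (jordanMap N k i (((truncatedShift P k) ^ l) p)) = 0 := by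
  have hp0 : ∀ j : Fin (k + 1), (j : ℕ) + l < k → p j = 0 := by
    intro j hj
    have := congrFun hp ⟨j + (l + 1), by omega⟩
    rw [truncatedShift_pow_apply] at this
    simpa using this
  rw [h.apply_jordanMap hi]
  refine Finset.sum_eq_zero fun j _ => ?_
  rcases lt_or_ge ((j : ℕ) + l) k with hj | hj
  · simp [hp0 j hj]
  · rw [truncatedShift_pow_apply]
    split_ifs with hlj
    · have hrev := Fin.val_rev j
      rw [hp0 ⟨j.rev - l, by omega⟩ (by simp only; omega)]
      simp
    · simp

/-- Correcting `i` by terms in the image of `N` kills all the pairings below the top one. -/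
theorem IsNilpotentIsometry.exists_normalized [FiniteDimensional ℝ P]
    (h : IsNilpotentIsometry Q N (k + 1))
    (hnd : ∀ u, (∀ v, Q (i u) ((N ^ k) (i v)) = 0) → u = 0) :
    ∃ i' : P →ₗ[ℝ] V, (∀ u v, Q (i' u) ((N ^ k) (i' v)) = Q (i u) ((N ^ k) (i v))) ∧
      ∀ j < k, ∀ u v, Q (i' u) ((N ^ j) (i' v)) = 0 := by
  suffices H : ∀ d ≤ k, ∃ i' : P →ₗ[ℝ] V,
      (∀ u v, Q (i' u) ((N ^ k) (i' v)) = Q (i u) ((N ^ k) (i v))) ∧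
      ∀ j < k, k ≤ j + d → ∀ u v, Q (i' u) ((N ^ j) (i' v)) = 0 by
    obtain ⟨i', h1, h2⟩ := H k le_rfl
    exact ⟨i', h1, fun j hj => h2 j hj (by omega)⟩
  intro d
  induction d with
  | zero => exact fun _ => ⟨i, fun _ _ => rfl, fun j hj hj' => by omega⟩
  | succ d ih =>
    intro hd
    obtain ⟨i', h1, h2⟩ := ih (by omega)
    obtain ⟨j₀, hj₀⟩ : ∃ j₀, k = j₀ + (d + 1) := ⟨k - (d + 1), by omega⟩
    obtain ⟨S, hS⟩ := exists_forall_apply_eq (Q.compl₁₂ i' ((N ^ k) ∘ₗ i'))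
      (fun u hu => hnd u fun v => by rw [← h1]; exact hu v)
      (((-1) ^ k * (-1 / 2) : ℝ) • (Q.compl₁₂ i' ((N ^ j₀) ∘ₗ i')).flip)
    simp only [LinearMap.compl₁₂_apply, LinearMap.smul_apply, LinearMap.flip_apply,
      LinearMap.comp_apply, smul_eq_mul] at hS
    have expand : ∀ j, j₀ ≤ j → ∀ u v,
        Q ((i' + (N ^ (d + 1)) ∘ₗ i' ∘ₗ S) u) ((N ^ j) ((i' + (N ^ (d + 1)) ∘ₗ i' ∘ₗ S) v)) =
          Q (i' u) ((N ^ j) (i' v)) + Q (i' u) ((N ^ (j + (d + 1))) (i' (S v))) +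
          (-1) ^ (d + 1) * Q (i' (S u)) ((N ^ (j + (d + 1))) (i' v)) := by
      intro j hj u v
      have hz : (N ^ (d + 1 + (j + (d + 1)))) (i' (S v)) = 0 :=
        h.pow_apply_eq_zero (by omega) _
      simp only [LinearMap.add_apply, LinearMap.comp_apply, map_add, h.apply_pow_left,
        ← Module.End.mul_apply, ← pow_add, hz, map_zero, add_comm (d + 1) j]
      ring
    have vanish : ∀ j, j₀ < j → ∀ u v,
        Q ((i' + (N ^ (d + 1)) ∘ₗ i' ∘ₗ S) u) ((N ^ j) ((i' + (N ^ (d + 1)) ∘ₗ i' ∘ₗ S) v)) =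
          Q (i' u) ((N ^ j) (i' v)) := by
      intro j hj u v
      have hz : ∀ w, (N ^ (j + (d + 1))) w = 0 := h.pow_apply_eq_zero (by omega)
      rw [expand j hj.le, hz, hz]
      simp
    refine ⟨i' + (N ^ (d + 1)) ∘ₗ i' ∘ₗ S, fun u v => by rw [vanish k (by omega), h1],
      fun j hj hjd u v => ?_⟩
    rcases (show j₀ ≤ j by omega).eq_or_lt with rfl | hlt
    · rw [expand j₀ le_rfl, ← hj₀, h.apply_pow_swap k (i' u), hS, hS,
        h.apply_pow_swap j₀ (i' v)]
      have e1 : ((-1 : ℝ) ^ k) * (-1) ^ k = 1 := by rw [← mul_pow]; simp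
      have e2 : (-1 : ℝ) ^ (d + 1) * (-1) ^ k * (-1) ^ j₀ = 1 := by
        rw [mul_assoc, mul_comm, mul_assoc, ← pow_add, ← hj₀, e1]
      linear_combination (-1 / 2 * Q (i' u) ((N ^ j₀) (i' v))) * (e1 + e2)
    · rw [vanish j hlt, h2 j hj (by omega)]

end Normalized

/-- `F` embeds `(M, S)` in `(V, N)` and `π` is the equivariant projection of `V` onto `M` along
the orthogonal complement of the image of `F`. -/
structure IsEquivariantSplitting (Q : V →ₗ[ℝ] V →ₗ[ℝ] ℝ) (N : End ℝ V) (S : End ℝ M)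
    (F : M →ₗ[ℝ] V) (π : V →ₗ[ℝ] M) : Prop where
  left_inv : ∀ m, π (F m) = m
  orthogonal : ∀ v m, Q (v - F (π v)) (F m) = 0
  map_comm : ∀ m, F (S m) = N (F m)
  proj_comm : ∀ v, π (N v) = S (π v)

/-- A top layer of Jordan blocks, indexed by a nondegenerate space, splits off. -/
theorem IsNilpotentIsometry.exists_splitting [FiniteDimensional ℝ P]
    {Q : V →ₗ[ℝ] V →ₗ[ℝ] ℝ} {N : End ℝ V} {k : ℕ} {i : P →ₗ[ℝ] V}
    (h : IsNilpotentIsometry Q N (k + 1))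
    (hi : ∀ j < k, ∀ u v, Q (i u) ((N ^ j) (i v)) = 0)
    (hnd : ∀ u, (∀ v, Q (i u) ((N ^ k) (i v)) = 0) → u = 0) :
    ∃ π, IsEquivariantSplitting Q N (truncatedShift P k) (jordanMap N k i) π := by
  have hz := h.eq_zero_of_apply_jordanMap hi hnd
  obtain ⟨π, h1, h2⟩ := exists_orthogonal_projection Q (jordanMap N k i) hz
  have comm := jordanMap_truncatedShift h.pow_eq_zero i
  refine ⟨π, h1, h2, comm, fun v => ?_⟩
  rw [← sub_eq_zero]
  refine hz _ fun q => ?_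
  have a1 := h2 (N v) q
  have a2 := h2 v (truncatedShift P k q)
  have a3 := h.skew v (jordanMap N k i q)
  have a4 := h.skew (jordanMap N k i (π v)) (jordanMap N k i q)
  rw [map_sub, LinearMap.sub_apply, sub_eq_zero] at a1 a2
  rw [comm] at a2
  rw [map_sub, map_sub, LinearMap.sub_apply, comm]
  linarith

namespace IsEquivariantSplitting

variable {Q : V →ₗ[ℝ] V →ₗ[ℝ] ℝ} {N : End ℝ V} {S : End ℝ M} {F : M →ₗ[ℝ] V} {π : V →ₗ[ℝ] M}

theorem map_pow (s : IsEquivariantSplitting Q N S F π) (l : ℕ) (m : M) :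
    F ((S ^ l) m) = (N ^ l) (F m) := by
  induction l with
  | zero => simp
  | succ l ih => rw [pow_succ', pow_succ', Module.End.mul_apply, s.map_comm, ih]; rfl

theorem proj_pow (s : IsEquivariantSplitting Q N S F π) (l : ℕ) (v : V) :
    π ((N ^ l) v) = (S ^ l) (π v) := by
  induction l with
  | zero => simp
  | succ l ih => rw [pow_succ', pow_succ', Module.End.mul_apply, s.proj_comm, ih]; rfl

theorem mapsTo_ker (s : IsEquivariantSplitting Q N S F π) :
    ∀ v ∈ LinearMap.ker π, N v ∈ LinearMap.ker π := fun v hv => by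
  rw [LinearMap.mem_ker] at *
  rw [s.proj_comm, hv, map_zero]

/-- The restriction of `N` to the complement. -/
def compl (s : IsEquivariantSplitting Q N S F π) : End ℝ (LinearMap.ker π) :=
  N.restrict s.mapsTo_ker

theorem coe_compl_pow (s : IsEquivariantSplitting Q N S F π) (l : ℕ) (u : LinearMap.ker π) :
    ((s.compl ^ l) u : V) = (N ^ l) u := by
  induction l with
  | zero => simp
  | succ l ih => rw [pow_succ', pow_succ', Module.End.mul_apply, Module.End.mul_apply, ← ih]; rfl

/-- The projection onto the complement. -/
def rest (s : IsEquivariantSplitting Q N S F π) : V →ₗ[ℝ] LinearMap.ker π :=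
  (LinearMap.id - F ∘ₗ π).codRestrict _ fun v => by simp [s.left_inv]

theorem coe_rest (s : IsEquivariantSplitting Q N S F π) (v : V) :
    (s.rest v : V) = v - F (π v) := rfl

theorem rest_pow (s : IsEquivariantSplitting Q N S F π) (l : ℕ) (v : V) :
    s.rest ((N ^ l) v) = (s.compl ^ l) (s.rest v) := by
  apply Subtype.ext
  rw [coe_compl_pow, coe_rest, coe_rest, s.proj_pow, s.map_pow, map_sub]

theorem apply_ker (s : IsEquivariantSplitting Q N S F π) (u : LinearMap.ker π) (m : M) :
    Q u (F m) = 0 := by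
  simpa [LinearMap.mem_ker.mp u.2] using s.orthogonal u m

theorem apply_eq (s : IsEquivariantSplitting Q N S F π) (hsymm : ∀ u v, Q u v = Q v u)
    (u v : V) : Q u v = Q (F (π u)) (F (π v)) + Q (s.rest u) (s.rest v) := by
  have e : Q u v = Q (F (π u) + s.rest u) (F (π v) + s.rest v) := by simp [coe_rest]
  rw [e]
  simp only [map_add, LinearMap.add_apply, s.apply_ker, hsymm (F _) (s.rest _ : V)]
  ring

theorem isNilpotentIsometry_compl (s : IsEquivariantSplitting Q N S F π) {k : ℕ}
    (h : IsNilpotentIsometry Q N (k + 1)) (hk : ∀ v, ∃ m, (N ^ k) v = F m) :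
    IsNilpotentIsometry
      (Q.compl₁₂ (LinearMap.ker π).subtype (LinearMap.ker π).subtype) s.compl k where
  nondegenerate u hu := by
    refine Subtype.ext (h.nondegenerate _ fun v => ?_)
    have := hu (s.rest v)
    rw [LinearMap.compl₁₂_apply, Submodule.subtype_apply, Submodule.subtype_apply, coe_rest,
      map_sub, s.apply_ker, sub_zero] at this
    exact this
  symm u v := h.symm _ _
  skew u v := h.skew _ _
  pow_eq_zero := by
    ext u
    obtain ⟨m, hm⟩ := hk u
    have h0 : m = 0 := by
      rw [← s.left_inv m, ← hm, s.proj_pow, LinearMap.mem_ker.mp u.2, map_zero]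
    rw [coe_compl_pow, hm, h0, map_zero, LinearMap.zero_apply, Submodule.coe_zero]

theorem finrank_range_pow [FiniteDimensional ℝ V] [FiniteDimensional ℝ M]
    (s : IsEquivariantSplitting Q N S F π) (l : ℕ) :
    finrank ℝ (LinearMap.range (N ^ l)) =
      finrank ℝ (LinearMap.range (S ^ l)) + finrank ℝ (LinearMap.range (s.compl ^ l)) := by
  let f : (LinearMap.range (S ^ l) × LinearMap.range (s.compl ^ l)) →ₗ[ℝ] V :=
    (F ∘ₗ (LinearMap.range (S ^ l)).subtype).coprod
      ((LinearMap.ker π).subtype ∘ₗ (LinearMap.range (s.compl ^ l)).subtype)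
  have hf : ∀ x, f x = F x.1 + x.2 := fun x => rfl
  have hinj : Function.Injective f := by
    rw [injective_iff_map_eq_zero]
    rintro ⟨a, b⟩ hab
    rw [hf] at hab
    have ha : (a : M) = 0 := by
      have := congrArg π hab
      rwa [map_add, s.left_inv, LinearMap.mem_ker.mp b.1.2, add_zero, map_zero] at this
    simp only [ha, map_zero, zero_add] at hab
    exact Prod.ext (Subtype.ext ha) (Subtype.ext (Subtype.ext hab))
  have hrange : LinearMap.range f = LinearMap.range (N ^ l) := by
    apply le_antisymm
    · rintro _ ⟨⟨⟨_, m, rfl⟩, ⟨_, u, rfl⟩⟩, rfl⟩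
      exact ⟨F m + u, by rw [hf, map_add, s.map_pow, s.coe_compl_pow]⟩
    · rintro _ ⟨v, rfl⟩
      refine ⟨⟨⟨_, π v, rfl⟩, ⟨_, s.rest v, rfl⟩⟩, ?_⟩
      rw [hf, s.map_pow, s.coe_compl_pow, ← map_add, coe_rest, add_sub_cancel]
  rw [← hrange, LinearMap.finrank_range_of_inj hinj, finrank_prod]

end IsEquivariantSplitting

/-- A complement of `ker (N ^ k)` carries the nondegenerate form `Q u (N ^ k v)`. -/
theorem IsNilpotentIsometry.exists_top_layer [FiniteDimensional ℝ V] {Q : V →ₗ[ℝ] V →ₗ[ℝ] ℝ}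
    {N : End ℝ V} {k n : ℕ} (h : IsNilpotentIsometry Q N n) :
    ∃ P : Submodule ℝ V, finrank ℝ P = finrank ℝ (LinearMap.range (N ^ k)) ∧
      ∀ u : P, (∀ v : P, Q u ((N ^ k) v) = 0) → u = 0 := by
  obtain ⟨P, hP⟩ := (LinearMap.ker (N ^ k)).exists_isCompl
  refine ⟨P, ?_, fun u hu => ?_⟩
  · have h1 := Submodule.finrank_add_eq_of_isCompl hP
    have h2 := (N ^ k).finrank_range_add_finrank_ker
    omega
  · have hker : (u : V) ∈ LinearMap.ker (N ^ k) := by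
      refine h.nondegenerate _ fun v => ?_
      obtain ⟨a, ha, p, hp, rfl⟩ : ∃ a ∈ LinearMap.ker (N ^ k), ∃ p ∈ P, a + p = v :=
        Submodule.mem_sup.mp (hP.sup_eq_top ▸ Submodule.mem_top)
      rw [h.apply_pow_left, map_add, LinearMap.mem_ker.mp ha, zero_add, hu ⟨p, hp⟩, mul_zero]
    exact Subtype.ext (Submodule.disjoint_def.mp hP.disjoint _ hker u.2)

theorem exists_pow_apply_eq_jordanMap [FiniteDimensional ℝ V] [FiniteDimensional ℝ P]
    {Q : V →ₗ[ℝ] V →ₗ[ℝ] ℝ} {N : End ℝ V} {k : ℕ} {i : P →ₗ[ℝ] V}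
    (hnd : ∀ u, (∀ v, Q (i v) ((N ^ k) (i u)) = 0) → u = 0)
    (hdim : finrank ℝ P = finrank ℝ (LinearMap.range (N ^ k))) (v : V) :
    ∃ p, (N ^ k) v = jordanMap N k i p := by
  have hinj : Function.Injective ((N ^ k) ∘ₗ i) := by
    rw [injective_iff_map_eq_zero]
    intro u hu
    refine hnd u fun w => ?_
    rw [LinearMap.comp_apply] at hu
    rw [hu, map_zero]
  have hrange := Submodule.eq_of_le_of_finrank_eq (LinearMap.range_comp_le_range i (N ^ k))
    ((LinearMap.finrank_range_of_inj hinj).trans hdim)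
  have hv : (N ^ k) v ∈ LinearMap.range ((N ^ k) ∘ₗ i) := hrange ▸ ⟨v, rfl⟩
  obtain ⟨u, hu⟩ := hv
  exact ⟨Pi.single (Fin.last k) u, by rw [jordanMap_single, Fin.val_last, ← hu]; rfl⟩

/-- The top layer of `N₁`, together with its form, embeds in the space of `N₂`. -/
theorem exists_top_isometry {V₁ V₂ : Type u} [AddCommGroup V₁] [Module ℝ V₁] [AddCommGroup V₂]
    [Module ℝ V₂] [FiniteDimensional ℝ V₁] [FiniteDimensional ℝ V₂]
    {Q₁ : V₁ →ₗ[ℝ] V₁ →ₗ[ℝ] ℝ} {Q₂ : V₂ →ₗ[ℝ] V₂ →ₗ[ℝ] ℝ} {N₁ : End ℝ V₁} {N₂ : End ℝ V₂}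
    {k n : ℕ} (h₁ : IsNilpotentIsometry Q₁ N₁ n) (h₂ : IsNilpotentIsometry Q₂ N₂ n)
    (hrank : finrank ℝ (LinearMap.range (N₁ ^ k)) = finrank ℝ (LinearMap.range (N₂ ^ k)))
    (φ : V₁ →ₗ[ℝ] V₂) (hφ : ∀ u, Q₂ (φ u) ((N₂ ^ k) (φ u)) = Q₁ u ((N₁ ^ k) u))
    (P : Submodule ℝ V₁) (hP : finrank ℝ P = finrank ℝ (LinearMap.range (N₁ ^ k)))
    (hnd : ∀ u : P, (∀ v : P, Q₁ u ((N₁ ^ k) v) = 0) → u = 0) :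
    ∃ i : P →ₗ[ℝ] V₂, ∀ u v : P, Q₂ (i u) ((N₂ ^ k) (i v)) = Q₁ u ((N₁ ^ k) v) := by
  rcases Nat.even_or_odd k with hk | hk
  · refine ⟨φ ∘ₗ P.subtype, fun u v => ?_⟩
    have e := hφ (u + v)
    have s₁ := h₁.apply_pow_swap k u v
    have s₂ := h₂.apply_pow_swap k (φ u) (φ v)
    rw [hk.neg_one_pow, one_mul] at s₁ s₂
    simp only [map_add, LinearMap.add_apply, hφ] at e
    simp only [LinearMap.comp_apply, Submodule.subtype_apply]
    linarith
  · obtain ⟨P₂, hP₂, hnd₂⟩ := h₂.exists_top_layer (k := k)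
    obtain ⟨f, hf⟩ := exists_isometry_of_alternating _
      (Q₁.compl₁₂ P.subtype ((N₁ ^ k) ∘ₗ P.subtype))
      (Q₂.compl₁₂ P₂.subtype ((N₂ ^ k) ∘ₗ P₂.subtype)) hnd hnd₂
      (fun u v => by
        have := h₁.apply_pow_swap k u v
        rwa [hk.neg_one_pow, neg_one_mul] at this)
      (fun u v => by
        have := h₂.apply_pow_swap k u v
        rwa [hk.neg_one_pow, neg_one_mul] at this)
      hP (by rw [hP₂, hrank])
    exact ⟨P₂.subtype ∘ₗ f, hf⟩

theorem exists_equivariant_isometry (k : ℕ) : ∀ {V₁ V₂ : Type u} [AddCommGroup V₁] [Module ℝ V₁]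
    [AddCommGroup V₂] [Module ℝ V₂] [FiniteDimensional ℝ V₁] [FiniteDimensional ℝ V₂]
    {Q₁ : V₁ →ₗ[ℝ] V₁ →ₗ[ℝ] ℝ} {Q₂ : V₂ →ₗ[ℝ] V₂ →ₗ[ℝ] ℝ} {N₁ : End ℝ V₁} {N₂ : End ℝ V₂},
    IsNilpotentIsometry Q₁ N₁ k → IsNilpotentIsometry Q₂ N₂ k →
    (∀ l, finrank ℝ (LinearMap.range (N₁ ^ l)) = finrank ℝ (LinearMap.range (N₂ ^ l))) →
    (∀ l, ∃ φ : V₁ →ₗ[ℝ] V₂, ∀ u, (N₁ ^ (l + 1)) u = 0 →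
      (N₂ ^ (l + 1)) (φ u) = 0 ∧ Q₂ (φ u) ((N₂ ^ l) (φ u)) = Q₁ u ((N₁ ^ l) u)) →
    ∃ g : V₁ →ₗ[ℝ] V₂, (∀ u v, Q₂ (g u) (g v) = Q₁ u v) ∧ ∀ u, g (N₁ u) = N₂ (g u) := by
  induction k with
  | zero =>
    intro V₁ V₂ _ _ _ _ _ _ Q₁ Q₂ N₁ N₂ h₁ _ _ _
    have h0 : ∀ u : V₁, u = 0 := fun u => h₁.pow_apply_eq_zero (j := 0) le_rfl u
    exact ⟨0, fun u v => by simp [h0 u], fun u => by simp⟩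
  | succ k ih =>
    intro V₁ V₂ _ _ _ _ _ _ Q₁ Q₂ N₁ N₂ h₁ h₂ hrank hφ
    obtain ⟨P, hP, hnd⟩ := h₁.exists_top_layer (k := k)
    obtain ⟨φ, hφk⟩ := hφ k
    obtain ⟨i, hi⟩ := exists_top_isometry h₁ h₂ (hrank k) φ
      (fun u => (hφk u (h₁.pow_apply_eq_zero le_rfl u)).2) P hP hnd
    have hnd₂ : ∀ u, (∀ v, Q₂ (i u) ((N₂ ^ k) (i v)) = 0) → u = 0 := by simpa only [hi] using hnd
    obtain ⟨i₁, t₁, n₁⟩ := h₁.exists_normalized (i := P.subtype) hnd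
    obtain ⟨i₂, t₂, n₂⟩ := h₂.exists_normalized hnd₂
    have top : ∀ u v, Q₁ (i₁ u) ((N₁ ^ k) (i₁ v)) = Q₂ (i₂ u) ((N₂ ^ k) (i₂ v)) := fun u v => by
      rw [t₁, t₂, hi]
      rfl
    have hnd₁' : ∀ u, (∀ v, Q₁ (i₁ u) ((N₁ ^ k) (i₁ v)) = 0) → u = 0 := by
      simpa only [t₁, Submodule.subtype_apply] using hnd
    have hnd₂' : ∀ u, (∀ v, Q₂ (i₂ u) ((N₂ ^ k) (i₂ v)) = 0) → u = 0 := by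
      simpa only [t₂] using hnd₂
    obtain ⟨π₁, s₁⟩ := h₁.exists_splitting n₁ hnd₁'
    obtain ⟨π₂, s₂⟩ := h₂.exists_splitting n₂ hnd₂'
    have c₁ := s₁.isNilpotentIsometry_compl h₁ (exists_pow_apply_eq_jordanMap (Q := Q₁)
      (fun u hu => hnd₁' u fun v => by rw [h₁.apply_pow_swap, hu, mul_zero]) hP)
    have c₂ := s₂.isNilpotentIsometry_compl h₂ (exists_pow_apply_eq_jordanMap (Q := Q₂)
      (fun u hu => hnd₂' u fun v => by rw [h₂.apply_pow_swap, hu, mul_zero])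
      (hP.trans (hrank k)))
    obtain ⟨g, hg, hgN⟩ := ih c₁ c₂
      (fun l => by
        have := hrank l
        rw [s₁.finrank_range_pow, s₂.finrank_range_pow] at this
        exact Nat.add_left_cancel this)
      (fun l => by
        rcases lt_or_ge l k with hl | hl
        · obtain ⟨ψ, hψ⟩ := hφ l
          refine ⟨s₂.rest ∘ₗ ψ ∘ₗ (LinearMap.ker π₁).subtype, fun u hu => ?_⟩
          obtain ⟨e1, e2⟩ := hψ u (by rw [← s₁.coe_compl_pow, hu, Submodule.coe_zero])
          refine ⟨?_, ?_⟩
          · simp only [LinearMap.comp_apply, Submodule.subtype_apply]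
            rw [← s₂.rest_pow, e1, map_zero]
          · simp only [LinearMap.comp_apply, Submodule.subtype_apply, LinearMap.compl₁₂_apply]
            rw [s₁.coe_compl_pow, ← e2, s₂.apply_eq h₂.symm (ψ u), s₂.proj_pow,
              h₂.apply_jordanMap_pow_eq_zero n₂ hl _ (by rw [← s₂.proj_pow, e1, map_zero]),
              zero_add, s₂.rest_pow]
        · exact ⟨0, fun u _ => by simp [c₁.pow_apply_eq_zero hl]⟩)
    refine ⟨jordanMap N₂ k i₂ ∘ₗ π₁ + (LinearMap.ker π₂).subtype ∘ₗ g ∘ₗ s₁.rest,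
      fun u v => ?_, fun u => ?_⟩
    · have e := hg (s₁.rest u) (s₁.rest v)
      simp only [LinearMap.compl₁₂_apply, Submodule.subtype_apply] at e
      rw [s₁.apply_eq h₁.symm u v, h₁.apply_jordanMap n₁]
      simp only [LinearMap.add_apply, LinearMap.comp_apply, Submodule.subtype_apply, map_add,
        s₂.apply_ker, h₂.symm (jordanMap N₂ k i₂ _) (g _ : V₂), e, h₂.apply_jordanMap n₂, top]
      ring
    · have e := s₁.rest_pow 1 u
      have e' := s₂.coe_compl_pow 1 (g (s₁.rest u))
      rw [pow_one, pow_one] at e e'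
      simp only [LinearMap.add_apply, LinearMap.comp_apply, Submodule.subtype_apply, map_add,
        s₁.proj_comm, s₂.map_comm, e, hgN, e']

end NilpotentIsometries


/-- For a nondegenerate symmetric bilinear form `Q` on a finite-dimensional
real vector space `V`, two nilpotent infinitesimal isometries `N₁, N₂` of `Q` are conjugate by
an element of `Aut(V, Q)` if and only if for every `ℓ ≥ 0`: `rank (N₁^ℓ) = rank (N₂^ℓ)` and
there is a linear isomorphism `φ : ker (N₁^(ℓ+1)) → ker (N₂^(ℓ+1))` with
`Q(φ u, N₂^ℓ (φ u)) = Q(u, N₁^ℓ u)` for all `u`.  (Classification of real orthogonal nilpotent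
orbits by signed Young diagrams.) -/
theorem stmt6 {V : Type} [AddCommGroup V] [Module ℝ V] [FiniteDimensional ℝ V]
    (Q : V →ₗ[ℝ] V →ₗ[ℝ] ℝ)
    (hQnd : ∀ u : V, (∀ v : V, Q u v = 0) → u = 0)
    (hQsymm : ∀ u v : V, Q u v = Q v u)
    (N₁ N₂ : Module.End ℝ V)
    (hN₁nil : IsNilpotent N₁) (hN₂nil : IsNilpotent N₂)
    (hN₁iso : ∀ u v : V, Q (N₁ u) v + Q u (N₁ v) = 0)
    (hN₂iso : ∀ u v : V, Q (N₂ u) v + Q u (N₂ v) = 0) :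
    (∃ g : V ≃ₗ[ℝ] V, (∀ u v : V, Q (g u) (g v) = Q u v) ∧
        (g : V →ₗ[ℝ] V) ∘ₗ N₁ ∘ₗ (g.symm : V →ₗ[ℝ] V) = N₂) ↔
      (∀ ℓ : ℕ,
        Module.finrank ℝ (LinearMap.range (N₁ ^ ℓ)) =
          Module.finrank ℝ (LinearMap.range (N₂ ^ ℓ)) ∧
        ∃ φ : LinearMap.ker (N₁ ^ (ℓ + 1)) ≃ₗ[ℝ] LinearMap.ker (N₂ ^ (ℓ + 1)),
          ∀ u : LinearMap.ker (N₁ ^ (ℓ + 1)),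
            Q (φ u : V) ((N₂ ^ ℓ) (φ u : V)) = Q (u : V) ((N₁ ^ ℓ) (u : V))) := by
  constructor
  · rintro ⟨g, hg, hgN⟩ l
    have comm : ∀ v, g (N₁ v) = N₂ (g v) := fun v => by simp [← hgN]
    have comm_pow : ∀ (j : ℕ) v, g ((N₁ ^ j) v) = (N₂ ^ j) (g v) := by
      intro j v
      induction j with
      | zero => simp
      | succ j ih =>
        rw [pow_succ', pow_succ', Module.End.mul_apply, Module.End.mul_apply, comm, ih]
    have hrange : (LinearMap.range (N₁ ^ l)).map (g : V →ₗ[ℝ] V) = LinearMap.range (N₂ ^ l) := by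
      ext x
      constructor
      · rintro ⟨_, ⟨v, rfl⟩, rfl⟩
        exact ⟨g v, (comm_pow l v).symm⟩
      · rintro ⟨v, rfl⟩
        refine ⟨_, ⟨g.symm v, rfl⟩, ?_⟩
        simp [comm_pow]
    have hker : (LinearMap.ker (N₁ ^ (l + 1))).map (g : V →ₗ[ℝ] V) =
        LinearMap.ker (N₂ ^ (l + 1)) := by
      ext x
      constructor
      · rintro ⟨v, hv, rfl⟩
        simpa [comm_pow] using congrArg g (LinearMap.mem_ker.mp hv)
      · intro hx
        refine ⟨g.symm x, ?_, by simp⟩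
        apply g.injective
        rw [comm_pow, g.apply_symm_apply, map_zero]
        exact hx
    refine ⟨?_, g.ofSubmodules _ _ hker, fun u => ?_⟩
    · rw [← hrange]
      exact (LinearEquiv.finrank_map_eq g _).symm
    · rw [LinearEquiv.ofSubmodules_apply, ← comm_pow, hg]
  · intro h
    obtain ⟨a, ha⟩ := hN₁nil
    obtain ⟨b, hb⟩ := hN₂nil
    have h₁ : IsNilpotentIsometry Q N₁ (a + b) :=
      ⟨hQnd, hQsymm, hN₁iso, pow_eq_zero_of_le (Nat.le_add_right a b) ha⟩
    have h₂ : IsNilpotentIsometry Q N₂ (a + b) :=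
      ⟨hQnd, hQsymm, hN₂iso, pow_eq_zero_of_le (Nat.le_add_left b a) hb⟩
    obtain ⟨g, hg, hgN⟩ := exists_equivariant_isometry (a + b) h₁ h₂ (fun l => (h l).1)
      (fun l => by
        obtain ⟨φ, hφ⟩ := (h l).2
        obtain ⟨ψ, hψ⟩ := LinearMap.exists_extend
          ((LinearMap.ker (N₂ ^ (l + 1))).subtype ∘ₗ φ.toLinearMap)
        refine ⟨ψ, fun u hu => ?_⟩
        have e : ψ u = φ ⟨u, hu⟩ := LinearMap.congr_fun hψ ⟨u, hu⟩
        rw [e]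
        exact ⟨(φ ⟨u, hu⟩).2, hφ ⟨u, hu⟩⟩)
    have hinj : Function.Injective g := by
      rw [injective_iff_map_eq_zero]
      intro u hu
      refine hQnd u fun v => ?_
      rw [← hg, hu, map_zero, LinearMap.zero_apply]
    refine ⟨LinearEquiv.ofInjectiveEndo g hinj, hg, LinearMap.ext fun v => ?_⟩
    obtain ⟨w, rfl⟩ := (LinearEquiv.ofInjectiveEndo g hinj).surjective v
    simp only [LinearMap.comp_apply, LinearEquiv.coe_coe, LinearEquiv.symm_apply_apply]
    exact hgN w
end

section
/- The set of nilpotent endomorphisms of V that are infinitesimal isometries of Q is a finite union of orbits under the conjugation action of Aut(V, Q); that is, there are only finitely many Aut(V, Q)-conjugacy classes of nilpotent infinitesimal isometries of Q. -/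
open Module in
/-- A bilinear form on a finite-dimensional space with no left kernel represents every
linear functional in the left variable. -/
theorem exists_form_eq {E : Type} [AddCommGroup E] [Module ℝ E] [FiniteDimensional ℝ E]
    (b : E →ₗ[ℝ] E →ₗ[ℝ] ℝ) (hb : ∀ x, (∀ y, b x y = 0) → x = 0) (φ : E →ₗ[ℝ] ℝ) :
    ∃ x, b x = φ := by
  have hinj : Function.Injective b := by
    rw [injective_iff_map_eq_zero]
    intro x hx
    exact hb x fun y => by simp [hx]
  have hfr : finrank ℝ E = finrank ℝ (E →ₗ[ℝ] ℝ) := (Subspace.dual_finrank_eq).symm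
  exact (LinearMap.injective_iff_surjective_of_finrank_eq_finrank hfr).1 hinj φ

/-- Composition with the inverse of a nondegenerate form: every bilinear form `c` is of the
shape `b (A x) y`. -/
theorem exists_end_form_eq {E : Type} [AddCommGroup E] [Module ℝ E] [FiniteDimensional ℝ E]
    (b : E →ₗ[ℝ] E →ₗ[ℝ] ℝ) (hb : ∀ x, (∀ y, b x y = 0) → x = 0)
    (c : E →ₗ[ℝ] E →ₗ[ℝ] ℝ) : ∃ A : E →ₗ[ℝ] E, ∀ x y, b (A x) y = c x y := by
  have hinj : Function.Injective b := by
    rw [injective_iff_map_eq_zero]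
    intro x hx
    exact hb x fun y => by simp [hx]
  let e := LinearEquiv.ofBijective b ⟨hinj, exists_form_eq b hb⟩
  refine ⟨e.symm.toLinearMap ∘ₗ c, fun x y => ?_⟩
  have : b (e.symm (c x)) = c x := e.apply_symm_apply (c x)
  simp [this]

section Skew

variable {V : Type} [AddCommGroup V] [Module ℝ V] {Q : V →ₗ[ℝ] V →ₗ[ℝ] ℝ}
  {N : Module.End ℝ V}

theorem form_pow_right (hN : ∀ u v, Q (N u) v + Q u (N v) = 0) (m : ℕ) (u v : V) :
    Q u ((N ^ m) v) = (-1) ^ m * Q ((N ^ m) u) v := by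
  induction m generalizing u v with
  | zero => simp
  | succ m ih =>
    have h := hN ((N ^ m) u) v
    have e1 : (N ^ (m + 1)) v = (N ^ m) (N v) := by rw [pow_succ]; rfl
    have e2 : (N ^ (m + 1)) u = N ((N ^ m) u) := by rw [pow_succ']; rfl
    rw [e1, e2, ih, pow_succ]
    linear_combination (-1) ^ m * h

theorem form_pow_symm {ε : ℝ} (hQ : ∀ u v, Q u v = ε * Q v u)
    (hN : ∀ u v, Q (N u) v + Q u (N v) = 0) (m : ℕ) (u v : V) :
    Q ((N ^ m) u) v = ε * (-1) ^ m * Q ((N ^ m) v) u := by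
  rw [hQ, form_pow_right hN]
  ring

/-- A map `f` which carries the form `b` in the top degree `k` can be corrected so that
the forms `Q (N ^ i (f x)) (f y)` vanish in the degrees `k - m ≤ i < k`. -/
theorem exists_normalized_map {ε : ℝ} (hε : ε * ε = 1) (hQ : ∀ u v, Q u v = ε * Q v u)
    (hN : ∀ u v, Q (N u) v + Q u (N v) = 0) {k : ℕ} (hk : N ^ (k + 1) = 0)
    {E : Type} [AddCommGroup E] [Module ℝ E] [FiniteDimensional ℝ E]
    (b : E →ₗ[ℝ] E →ₗ[ℝ] ℝ) (hb : ∀ x, (∀ y, b x y = 0) → x = 0)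
    (f : E →ₗ[ℝ] V) (hf : ∀ x y, Q ((N ^ k) (f x)) (f y) = b x y) (m : ℕ) :
    ∃ f' : E →ₗ[ℝ] V, (∀ x y, Q ((N ^ k) (f' x)) (f' y) = b x y) ∧
      ∀ i, i < k → k ≤ i + m → ∀ x y, Q ((N ^ i) (f' x)) (f' y) = 0 := by
  have hbig : ∀ i, k < i → ∀ v, (N ^ i) v = 0 := by
    intro i hi v
    rw [pow_eq_zero_of_le hi hk]
    rfl
  induction m with
  | zero => exact ⟨f, hf, fun i h1 h2 => by omega⟩
  | succ m ih =>
    obtain ⟨f, hf, hz⟩ := ih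
    by_cases hmk : k < m + 1
    · exact ⟨f, hf, fun i h1 h2 => hz i h1 (by omega)⟩
    obtain ⟨j, hj⟩ : ∃ j, k = j + (m + 1) := ⟨k - (m + 1), by omega⟩
    obtain ⟨A, hA⟩ := exists_end_form_eq b hb
      ((-1 / 2 : ℝ) • (Q.compl₁₂ ((N ^ j) ∘ₗ f) f))
    have hA' : ∀ x y, b (A x) y = -1 / 2 * Q ((N ^ j) (f x)) (f y) := by
      intro x y
      rw [hA]
      simp
    have hexp : ∀ i x y,
        Q ((N ^ i) ((f + (N ^ (m + 1)) ∘ₗ f ∘ₗ A) x)) ((f + (N ^ (m + 1)) ∘ₗ f ∘ₗ A) y) =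
          Q ((N ^ i) (f x)) (f y) + Q ((N ^ (i + (m + 1))) (f (A x))) (f y)
          + (-1) ^ (m + 1) * Q ((N ^ (i + (m + 1))) (f x)) (f (A y))
          + (-1) ^ (m + 1) * Q ((N ^ (i + (m + 1) + (m + 1))) (f (A x))) (f (A y)) := by
      intro i x y
      have e : ∀ p v, (N ^ p) ((N ^ (m + 1)) v) = (N ^ (p + (m + 1))) v := by
        intro p v
        exact (LinearMap.congr_fun (pow_add N p (m + 1)) v).symm
      have e' : ∀ p v, (N ^ (m + 1)) ((N ^ p) v) = (N ^ (p + (m + 1))) v := by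
        intro p v
        rw [add_comm p]
        exact (LinearMap.congr_fun (pow_add N (m + 1) p) v).symm
      simp only [LinearMap.add_apply, LinearMap.comp_apply, map_add, e,
        form_pow_right hN (m + 1), e']
      ring
    refine ⟨f + (N ^ (m + 1)) ∘ₗ f ∘ₗ A, fun x y => ?_, fun i hik him x y => ?_⟩
    · rw [hexp, hbig (k + (m + 1)) (by omega), hbig (k + (m + 1)) (by omega),
        hbig (k + (m + 1) + (m + 1)) (by omega), hf]
      simp
    · rw [hexp]
      rcases Nat.lt_or_ge j i with hji | hji
      · rw [hbig (i + (m + 1)) (by omega), hbig (i + (m + 1)) (by omega),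
          hbig (i + (m + 1) + (m + 1)) (by omega), hz i hik (by omega)]
        simp
      · obtain rfl : i = j := by omega
        rw [hbig (i + (m + 1) + (m + 1)) (by omega), ← hj,
          form_pow_symm hQ hN k (f x) (f (A y)), hf, hf, hA', hA',
          form_pow_symm hQ hN i (f y) (f x), hj,
          pow_add (-1 : ℝ) i (m + 1)]
        have h1 : ((-1 : ℝ) ^ (m + 1)) * (-1) ^ (m + 1) = 1 := by
          rw [← mul_pow]; simp
        have h2 : ((-1 : ℝ) ^ i) * (-1) ^ i = 1 := by
          rw [← mul_pow]; simp
        simp only [map_zero, LinearMap.zero_apply, mul_zero, add_zero]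
        generalize (-1 : ℝ) ^ (m + 1) = s at h1 ⊢
        generalize (-1 : ℝ) ^ i = t at h2 ⊢
        generalize Q ((N ^ i) (f x)) (f y) = q
        linear_combination (-1 / 2 * q * s * s * t * t) * hε +
          (-1 / 2 * q * t * t) * h1 + (-1 / 2 * q) * h2

end Skew

/-- A real vector space with a bilinear form and an endomorphism. -/
structure FormEnd where
  carrier : Type
  [group : AddCommGroup carrier]
  [module : Module ℝ carrier]
  form : carrier →ₗ[ℝ] carrier →ₗ[ℝ] ℝ
  endo : Module.End ℝ carrier

namespace FormEnd

attribute [instance] FormEnd.group FormEnd.module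

/-- Isometries intertwining the endomorphisms. -/
def Iso (X Y : FormEnd) : Prop :=
  ∃ g : X.carrier ≃ₗ[ℝ] Y.carrier, (∀ u v, Y.form (g u) (g v) = X.form u v) ∧
    ∀ u, g (X.endo u) = Y.endo (g u)

/-- Orthogonal direct sum. -/
def prod (X Y : FormEnd) : FormEnd where
  carrier := X.carrier × Y.carrier
  form := X.form.compl₁₂ (LinearMap.fst ℝ _ _) (LinearMap.fst ℝ _ _) +
    Y.form.compl₁₂ (LinearMap.snd ℝ _ _) (LinearMap.snd ℝ _ _)
  endo := X.endo.prodMap Y.endo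

/-- Nondegenerate, `ε`-symmetric, with a nilpotent infinitesimal isometry. -/
structure Good (ε : ℝ) (X : FormEnd) : Prop where
  finite : FiniteDimensional ℝ X.carrier
  nondeg : ∀ u, (∀ v, X.form u v = 0) → u = 0
  symm : ∀ u v, X.form u v = ε * X.form v u
  nilp : IsNilpotent X.endo
  skew : ∀ u v, X.form (X.endo u) v + X.form u (X.endo v) = 0

/-- The form on `k + 1` copies of `E` for which the shift is skew, with top form `b`. -/
def blockForm (k : ℕ) {E : Type} [AddCommGroup E] [Module ℝ E] (b : E →ₗ[ℝ] E →ₗ[ℝ] ℝ) :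
    (Fin (k + 1) → E) →ₗ[ℝ] (Fin (k + 1) → E) →ₗ[ℝ] ℝ :=
  ∑ i : Fin (k + 1), (-1 : ℝ) ^ (i.rev : ℕ) •
    b.compl₁₂ (LinearMap.proj i) (LinearMap.proj i.rev)

/-- The shift on `k + 1` copies of `E`. -/
def shift (k : ℕ) (E : Type) [AddCommGroup E] [Module ℝ E] : Module.End ℝ (Fin (k + 1) → E) :=
  LinearMap.pi (Fin.cons 0 fun i : Fin k => LinearMap.proj i.castSucc)

/-- The block of length `k + 1` whose top form is `b`. -/
def block (k : ℕ) {E : Type} [AddCommGroup E] [Module ℝ E] (b : E →ₗ[ℝ] E →ₗ[ℝ] ℝ) :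
    FormEnd where
  carrier := Fin (k + 1) → E
  form := blockForm k b
  endo := shift k E

theorem Iso.symm {X Y : FormEnd} (h : Iso X Y) : Iso Y X := by
  obtain ⟨g, hg, hN⟩ := h
  refine ⟨g.symm, fun u v => ?_, fun u => ?_⟩
  · rw [← hg]; simp
  · apply g.injective
    rw [hN]; simp

theorem Iso.trans {X Y Z : FormEnd} (h : Iso X Y) (h' : Iso Y Z) : Iso X Z := by
  obtain ⟨g, hg, hN⟩ := h
  obtain ⟨g', hg', hN'⟩ := h'
  exact ⟨g.trans g', fun u v => by simp [hg, hg'], fun u => by simp [hN, hN']⟩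

theorem Iso.prod_right (X : FormEnd) {Y Z : FormEnd} (h : Iso Y Z) :
    Iso (X.prod Y) (X.prod Z) := by
  obtain ⟨g, hg, hN⟩ := h
  refine ⟨(LinearEquiv.refl ℝ X.carrier).prodCongr g, fun u v => ?_, fun u => ?_⟩
  · change X.form u.1 v.1 + Z.form (g u.2) (g v.2) = X.form u.1 v.1 + Y.form u.2 v.2
    rw [hg]
  · change (X.endo u.1, g (Y.endo u.2)) = (X.endo u.1, Z.endo (g u.2))
    rw [hN]

open Module in
/-- A nondegenerate invariant subspace splits off orthogonally. -/
theorem Good.exists_iso_prod {ε : ℝ} {X : FormEnd} (hX : X.Good ε) (M : FormEnd)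
    [FiniteDimensional ℝ M.carrier]
    (hM : ∀ y, (∀ x, M.form x y = 0) → y = 0) (Φ : M.carrier →ₗ[ℝ] X.carrier)
    (hΦ : ∀ x y, X.form (Φ x) (Φ y) = M.form x y)
    (hE : ∀ x, X.endo (Φ x) = Φ (M.endo x)) :
    ∃ Y : FormEnd, Y.Good ε ∧ Iso (M.prod Y) X ∧
      finrank ℝ M.carrier + finrank ℝ Y.carrier = finrank ℝ X.carrier := by
  have := hX.finite
  let U : Submodule ℝ X.carrier := LinearMap.ker (X.form ∘ₗ Φ).flip
  have hU : ∀ v, v ∈ U ↔ ∀ x, X.form (Φ x) v = 0 := by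
    intro v
    simp [U, LinearMap.mem_ker, LinearMap.ext_iff]
  have hU' : ∀ v ∈ U, ∀ x, X.form v (Φ x) = 0 := by
    intro v hv x
    rw [hX.symm, (hU v).1 hv, mul_zero]
  have hinv : ∀ v ∈ U, X.endo v ∈ U := by
    intro v hv
    rw [hU]
    intro x
    have h := hX.skew (Φ x) v
    rw [hE, (hU v).1 hv, zero_add] at h
    exact h
  let Y : FormEnd := ⟨U, X.form.compl₁₂ U.subtype U.subtype, X.endo.restrict hinv⟩
  let Ψ : (M.carrier × U) →ₗ[ℝ] X.carrier := Φ.coprod U.subtype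
  have hΨ : Function.Bijective Ψ := by
    constructor
    · rw [injective_iff_map_eq_zero]
      rintro ⟨x, u⟩ h
      have h0 : Φ x + u = 0 := h
      have hx : x = 0 := by
        apply hM
        intro z
        have h1 := congrArg (X.form (Φ z)) h0
        rw [map_add, hΦ, (hU u).1 u.2] at h1
        simpa using h1
      subst hx
      have : (u : X.carrier) = 0 := by simpa using h0
      simpa using this
    · intro v
      obtain ⟨x, hx⟩ := exists_form_eq M.form.flip (fun y hy => hM y hy)
        ((X.form ∘ₗ Φ).flip v)
      refine ⟨(x, ⟨v - Φ x, ?_⟩), ?_⟩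
      · rw [hU]
        intro z
        have h1 := LinearMap.congr_fun hx z
        simp only [LinearMap.flip_apply, LinearMap.comp_apply] at h1
        rw [map_sub, hΦ, h1, sub_self]
      · simp [Ψ]
  let e := LinearEquiv.ofBijective Ψ hΨ
  refine ⟨Y, ⟨?_, ?_, ?_, ?_, ?_⟩, ⟨e, ?_, ?_⟩, ?_⟩
  · exact inferInstanceAs (FiniteDimensional ℝ U)
  · intro u hu
    apply Subtype.ext
    apply hX.nondeg
    intro v
    obtain ⟨⟨x, w⟩, rfl⟩ := hΨ.2 v
    have h1 : X.form (u : U) (w : U) = 0 := hu w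
    have h2 : Ψ (x, w) = Φ x + w := rfl
    rw [h2, map_add, hU' _ (Subtype.property u), h1, add_zero]
  · intro u v
    exact hX.symm _ _
  · exact Module.End.isNilpotent.restrict hinv hX.nilp
  · intro u v
    exact hX.skew _ _
  · rintro ⟨x, u⟩ ⟨y, v⟩
    change X.form (Φ x + (u : U)) (Φ y + (v : U)) = M.form x y + X.form (u : U) (v : U)
    rw [map_add, map_add, LinearMap.add_apply, LinearMap.add_apply, hΦ,
      (hU _).1 (Subtype.property v), hU' _ (Subtype.property u)]
    ring
  · rintro ⟨x, u⟩
    change Φ (M.endo x) + X.endo (u : U) = X.endo (Φ x + (u : U))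
    rw [map_add, hE]
  · have := e.finrank_eq
    rw [finrank_prod] at this
    exact this

section Block

variable {k : ℕ} {E : Type} [AddCommGroup E] [Module ℝ E] (b : E →ₗ[ℝ] E →ₗ[ℝ] ℝ)

theorem blockForm_apply (x y : Fin (k + 1) → E) :
    blockForm k b x y = ∑ i, (-1 : ℝ) ^ (i.rev : ℕ) * b (x i) (y i.rev) := by
  simp [blockForm, LinearMap.sum_apply]

theorem blockForm_nondeg (hb : ∀ y, (∀ x, b x y = 0) → y = 0)
    (y : Fin (k + 1) → E) (hy : ∀ x, blockForm k b x y = 0) : y = 0 := by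
  have h : ∀ i : Fin (k + 1), y i.rev = 0 := by
    intro i
    apply hb
    intro e
    have h1 := hy (Pi.single i e)
    rw [blockForm_apply, Finset.sum_eq_single i] at h1
    · simpa using h1
    · intro j _ hj
      simp [Pi.single_eq_of_ne hj]
    · simp
  funext i
  simpa using h i.rev

/-- The map of a block into a space with a nilpotent endomorphism determined by the images of
the generators. -/
theorem exists_block_map {X : FormEnd}
    (hN : ∀ u v, X.form (X.endo u) v + X.form u (X.endo v) = 0)
    (hk : X.endo ^ (k + 1) = 0) (f : E →ₗ[ℝ] X.carrier)
    (hf : ∀ x y, X.form ((X.endo ^ k) (f x)) (f y) = b x y)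
    (hz : ∀ i, i < k → ∀ x y, X.form ((X.endo ^ i) (f x)) (f y) = 0) :
    ∃ Φ : (Fin (k + 1) → E) →ₗ[ℝ] X.carrier,
      (∀ x y, X.form (Φ x) (Φ y) = blockForm k b x y) ∧
      ∀ x, X.endo (Φ x) = Φ (shift k E x) := by
  let Φ : (Fin (k + 1) → E) →ₗ[ℝ] X.carrier :=
    ∑ i : Fin (k + 1), (X.endo ^ (i : ℕ)) ∘ₗ f ∘ₗ LinearMap.proj i
  have hΦ : ∀ x, Φ x = ∑ i : Fin (k + 1), (X.endo ^ (i : ℕ)) (f (x i)) := by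
    intro x
    simp [Φ, LinearMap.sum_apply]
  have hpow : ∀ i j : ℕ, ∀ v, (X.endo ^ i) ((X.endo ^ j) v) = (X.endo ^ (i + j)) v := by
    intro i j v
    exact (LinearMap.congr_fun (pow_add X.endo i j) v).symm
  refine ⟨Φ, fun x y => ?_, fun x => ?_⟩
  · rw [blockForm_apply, hΦ, hΦ, map_sum X.form, LinearMap.sum_apply]
    refine Finset.sum_congr rfl fun i _ => ?_
    rw [map_sum, Finset.sum_eq_single i.rev]
    · rw [form_pow_right hN, hpow,
        show ((i.rev : ℕ) + i : ℕ) = k by rw [Fin.val_rev]; omega, hf]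
    · intro j _ hj
      rw [form_pow_right hN, hpow]
      have hne : (j : ℕ) + i ≠ k := by
        intro h
        apply hj
        apply Fin.ext
        rw [Fin.val_rev]
        omega
      rcases Nat.lt_or_gt_of_ne hne with h | h
      · rw [hz _ h, mul_zero]
      · rw [pow_eq_zero_of_le h hk]
        simp
    · simp
  · have h0 : shift k E x 0 = 0 := by simp [shift]
    have h1 : ∀ i : Fin k, shift k E x i.succ = x i.castSucc := by simp [shift]
    rw [hΦ, hΦ, Fin.sum_univ_castSucc, Fin.sum_univ_succ, map_add, map_sum]
    have h2 : ∀ i : ℕ, ∀ v, X.endo ((X.endo ^ i) v) = (X.endo ^ (i + 1)) v := by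
      intro i v
      rw [pow_succ']; rfl
    simp [h0, h1, h2, hk]

open Module in
/-- A map with nondegenerate top form gives an orthogonal splitting of a block. -/
theorem Good.exists_iso_block_prod {ε : ℝ} (hε : ε * ε = 1) {X : FormEnd} (hX : X.Good ε)
    [FiniteDimensional ℝ E] [Nontrivial E] (hk : X.endo ^ (k + 1) = 0)
    (hb : ∀ x, (∀ y, b x y = 0) → x = 0) (hb' : ∀ y, (∀ x, b x y = 0) → y = 0)
    (f : E →ₗ[ℝ] X.carrier) (hf : ∀ x y, X.form ((X.endo ^ k) (f x)) (f y) = b x y) :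
    ∃ Y : FormEnd, Y.Good ε ∧ Iso ((block k b).prod Y) X ∧
      k + 1 + finrank ℝ Y.carrier ≤ finrank ℝ X.carrier := by
  obtain ⟨f, hf, hz⟩ := exists_normalized_map hε hX.symm hX.skew hk b hb f hf k
  obtain ⟨Φ, h1, h2⟩ := exists_block_map b hX.skew hk f hf
    fun i hi => hz i hi (by omega)
  have : FiniteDimensional ℝ (block k b).carrier :=
    inferInstanceAs (FiniteDimensional ℝ (Fin (k + 1) → E))
  obtain ⟨Y, hY, hi, hr⟩ := hX.exists_iso_prod (block k b) (blockForm_nondeg b hb') Φ h1 h2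
  refine ⟨Y, hY, hi, ?_⟩
  have h3 : finrank ℝ (block k b).carrier = (k + 1) * finrank ℝ E := by
    change finrank ℝ (Fin (k + 1) → E) = _
    simp [finrank_pi_fintype]
  have h4 : 0 < finrank ℝ E := finrank_pos
  nlinarith

end Block

/-- The standard symplectic form on the plane. -/
def planeForm : (ℝ × ℝ) →ₗ[ℝ] (ℝ × ℝ) →ₗ[ℝ] ℝ :=
  (LinearMap.mul ℝ ℝ).compl₁₂ (LinearMap.fst ℝ ℝ ℝ) (LinearMap.snd ℝ ℝ ℝ) -
    (LinearMap.mul ℝ ℝ).compl₁₂ (LinearMap.snd ℝ ℝ ℝ) (LinearMap.fst ℝ ℝ ℝ)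

theorem planeForm_apply (x y : ℝ × ℝ) : planeForm x y = x.1 * y.2 - x.2 * y.1 := by
  simp [planeForm]

/-- The indecomposable blocks of length `k + 1`. -/
def blocks (k : ℕ) : Set FormEnd :=
  {block k (LinearMap.mul ℝ ℝ), block k (-LinearMap.mul ℝ ℝ), block k planeForm}

open Module in
theorem Good.exists_block {ε : ℝ} (hε : ε = 1 ∨ ε = -1) {X : FormEnd} (hX : X.Good ε)
    [Nontrivial X.carrier] :
    ∃ k, ∃ B ∈ blocks k, ∃ Y : FormEnd, Y.Good ε ∧ Iso (B.prod Y) X ∧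
      k + 1 + finrank ℝ Y.carrier ≤ finrank ℝ X.carrier := by
  have hε2 : ε * ε = 1 := by rcases hε with h | h <;> simp [h]
  obtain ⟨k, hk, hk'⟩ : ∃ k, X.endo ^ (k + 1) = 0 ∧ X.endo ^ k ≠ 0 := by
    classical
    have h0 : Nat.find hX.nilp ≠ 0 := by
      intro h
      have := Nat.find_spec hX.nilp
      rw [h, pow_zero] at this
      exact one_ne_zero this
    obtain ⟨k, hk⟩ := Nat.exists_eq_succ_of_ne_zero h0
    refine ⟨k, ?_, Nat.find_min hX.nilp (by omega)⟩
    have := Nat.find_spec hX.nilp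
    rwa [hk] at this
  obtain ⟨u, v, huv⟩ : ∃ u v, X.form ((X.endo ^ k) u) v ≠ 0 := by
    by_contra! h
    exact hk' (LinearMap.ext fun u => hX.nondeg _ (h u))
  by_cases hq : ∃ u, X.form ((X.endo ^ k) u) u ≠ 0
  · obtain ⟨u, hu⟩ := hq
    set c := X.form ((X.endo ^ k) u) u with hc
    have hr : Real.sqrt |c| * Real.sqrt |c| = |c| := Real.mul_self_sqrt (abs_nonneg c)
    have hf : ∀ x y : ℝ, X.form ((X.endo ^ k)
        (LinearMap.toSpanSingleton ℝ X.carrier ((Real.sqrt |c|)⁻¹ • u) x))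
        (LinearMap.toSpanSingleton ℝ X.carrier ((Real.sqrt |c|)⁻¹ • u) y) =
          c / |c| * (x * y) := by
      intro x y
      have hi : |c|⁻¹ = (Real.sqrt |c|)⁻¹ * (Real.sqrt |c|)⁻¹ := by rw [← mul_inv, hr]
      rw [div_eq_mul_inv, hi]
      simp only [LinearMap.toSpanSingleton_apply, map_smul, LinearMap.smul_apply,
        smul_eq_mul, ← hc]
      ring
    rcases lt_or_gt_of_ne hu with hneg | hpos
    · obtain ⟨Y, hY⟩ := hX.exists_iso_block_prod (-LinearMap.mul ℝ ℝ) hε2 hk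
        (fun x h => by simpa using h 1) (fun x h => by simpa using h 1) _
        (fun x y => by
          rw [hf, abs_of_neg hneg, div_neg, div_self hu]
          simp)
      exact ⟨k, _, by simp [blocks], Y, hY⟩
    · obtain ⟨Y, hY⟩ := hX.exists_iso_block_prod (LinearMap.mul ℝ ℝ) hε2 hk
        (fun x h => by simpa using h 1) (fun x h => by simpa using h 1) _
        (fun x y => by
          rw [hf, abs_of_pos hpos, div_self hu]
          simp)
      exact ⟨k, _, by simp [blocks], Y, hY⟩
  · push Not at hq
    have hskew : ∀ u v, X.form ((X.endo ^ k) u) v = - X.form ((X.endo ^ k) v) u := by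
      intro u v
      have h := hq (u + v)
      simp only [map_add, LinearMap.add_apply, hq] at h
      linarith
    let w := (X.form ((X.endo ^ k) u) v)⁻¹ • v
    have huw : X.form ((X.endo ^ k) u) w = 1 := by
      simp [w, huv]
    obtain ⟨Y, hY⟩ := hX.exists_iso_block_prod planeForm hε2 hk
      (fun x h => by
        have h1 := h (1, 0)
        have h2 := h (0, 1)
        simp only [planeForm_apply] at h1 h2
        ext <;> simp <;> linarith)
      (fun x h => by
        have h1 := h (1, 0)
        have h2 := h (0, 1)
        simp only [planeForm_apply] at h1 h2
        ext <;> simp <;> linarith)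
      ((LinearMap.toSpanSingleton ℝ X.carrier u).coprod
        (LinearMap.toSpanSingleton ℝ X.carrier w))
      (fun x y => by
        simp only [LinearMap.coprod_apply, LinearMap.toSpanSingleton_apply, map_add,
          LinearMap.add_apply, map_smul, LinearMap.smul_apply, hq, huw, hskew w u,
          planeForm_apply, smul_eq_mul]
        ring)
    exact ⟨k, _, by simp [blocks], Y, hY⟩

/-- The zero space. -/
def zero : FormEnd := ⟨PUnit, 0, 0⟩

open Module in
/-- Up to isomorphism there are finitely many good triples of bounded dimension. -/
theorem exists_finite_models {ε : ℝ} (hε : ε = 1 ∨ ε = -1) (n : ℕ) :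
    ∃ S : Set FormEnd, S.Finite ∧
      ∀ X : FormEnd, X.Good ε → finrank ℝ X.carrier < n → ∃ Y ∈ S, Iso Y X := by
  induction n with
  | zero => exact ⟨∅, Set.finite_empty, fun X _ h => absurd h (Nat.not_lt_zero _)⟩
  | succ n ih =>
    obtain ⟨S, hS, hcov⟩ := ih
    refine ⟨{zero} ∪ Set.image2 prod (⋃ k ∈ Set.Iio n, blocks k) S, ?_, fun X hX hr => ?_⟩
    · refine (Set.finite_singleton _).union (Set.Finite.image2 _ ?_ hS)
      exact (Set.finite_Iio n).biUnion fun k _ => by simp [blocks]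
    · rcases subsingleton_or_nontrivial X.carrier with hsub | hnt
      · refine ⟨zero, Or.inl rfl, ?_⟩
        have : Subsingleton zero.carrier := inferInstanceAs (Subsingleton PUnit)
        refine ⟨0, fun u v => ?_, fun u => Subsingleton.elim _ _⟩
        rw [Subsingleton.elim u 0]
        simp
      · obtain ⟨k, B, hB, Y, hY, hi, hle⟩ := hX.exists_block hε
        obtain ⟨Z, hZ, hZY⟩ := hcov Y hY (by omega)
        refine ⟨B.prod Z, Or.inr ⟨B, ?_, Z, hZ, rfl⟩, (hZY.prod_right B).trans hi⟩
        exact Set.mem_biUnion (show k ∈ Set.Iio n by simp only [Set.mem_Iio]; omega) hB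

end FormEnd

/-- Let `Q` be a nondegenerate bilinear form on a finite-dimensional real vector
space `V` which is either symmetric or skew-symmetric.  The set of nilpotent infinitesimal
isometries of `Q` is a finite union of orbits under the conjugation action of `Aut(V, Q)`:
there are finitely many `Aut(V, Q)`-conjugacy classes of nilpotent infinitesimal isometries. -/
theorem stmt7 {V : Type} [AddCommGroup V] [Module ℝ V] [FiniteDimensional ℝ V]
    (Q : V →ₗ[ℝ] V →ₗ[ℝ] ℝ)
    (hQnd : ∀ u : V, (∀ v : V, Q u v = 0) → u = 0)
    (hQ : (∀ u v : V, Q u v = Q v u) ∨ (∀ u v : V, Q u v = - Q v u)) :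
    ∃ s : Finset (Module.End ℝ V),
      ∀ N : Module.End ℝ V, IsNilpotent N → (∀ u v : V, Q (N u) v + Q u (N v) = 0) →
        ∃ N₀ ∈ s, ∃ g : V ≃ₗ[ℝ] V, (∀ u v : V, Q (g u) (g v) = Q u v) ∧
          (g : V →ₗ[ℝ] V) ∘ₗ N₀ ∘ₗ (g.symm : V →ₗ[ℝ] V) = N := by
  classical
  obtain ⟨ε, hε, hsym⟩ : ∃ ε : ℝ, (ε = 1 ∨ ε = -1) ∧ ∀ u v, Q u v = ε * Q v u := by
    rcases hQ with h | h
    · exact ⟨1, Or.inl rfl, fun u v => by rw [one_mul, h]⟩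
    · exact ⟨-1, Or.inr rfl, fun u v => by rw [h]; ring⟩
  obtain ⟨S, hS, hcov⟩ := FormEnd.exists_finite_models hε (Module.finrank ℝ V + 1)
  let rep : FormEnd → Module.End ℝ V := fun Y =>
    if h : ∃ N : Module.End ℝ V, Y.Iso ⟨V, Q, N⟩ then h.choose else 0
  refine ⟨hS.toFinset.image rep, fun N hnil hskew => ?_⟩
  obtain ⟨Y, hYS, hY⟩ := hcov ⟨V, Q, N⟩ ⟨inferInstance, hQnd, hsym, hnil, hskew⟩
    (Nat.lt_succ_self _)
  have hex : ∃ N : Module.End ℝ V, Y.Iso ⟨V, Q, N⟩ := ⟨N, hY⟩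
  have hrep : Y.Iso ⟨V, Q, rep Y⟩ := by
    simp only [rep, dif_pos hex]
    exact hex.choose_spec
  refine ⟨rep Y, Finset.mem_image_of_mem _ (hS.mem_toFinset.2 hYS), ?_⟩
  obtain ⟨g, hg, hgN⟩ := hrep.symm.trans hY
  refine ⟨g, hg, LinearMap.ext fun u => ?_⟩
  have h := hgN (g.symm u)
  rw [LinearEquiv.apply_symm_apply] at h
  exact h
end
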